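/- arXiv:2401.16707 — 5 statements merged into one kernel-verified Lean document; each statement's English description precedes it below -/
import Mathlib

section
/- If the joint distribution p_{XY} is singular, then the minimum average rate satisfies lim_{n→∞} (R_n − I(X;Y)) / ((log₂ n)/n) = 0; that is, the redundancy of exact channel synthesis for a singular channel is sublogarithmic in the block length. -/
open MeasureTheory ProbabilityTheory Filter
open scoped ProbabilityTheory ENNReal

noncomputable section

/-- Binary strings `{0,1}*` carry the discrete σ-algebra. -/
instance : MeasurableSpace (List Bool) := ⊤

variable {𝒳 𝒴 : Type} [MeasurableSpace 𝒳] [StandardBorelSpace 𝒳]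
  [MeasurableSpace 𝒴] [StandardBorelSpace 𝒴]

/-- The joint measure `p_{XY} = p_X ⊗ p_{Y|X}` on `𝒳 × 𝒴` induced by the source `p_X` and
the channel (Markov kernel) `κ = p_{Y|X}`. -/
def pXY (pX : Measure 𝒳) (κ : Kernel 𝒳 𝒴) [IsMarkovKernel κ] : Measure (𝒳 × 𝒴) :=
  pX ⊗ₘ κ

/-- The output marginal `p_Y`. -/
def pYout (pX : Measure 𝒳) (κ : Kernel 𝒳 𝒴) [IsMarkovKernel κ] : Measure 𝒴 :=
  (pXY pX κ).snd

/-- The pointwise log-likelihood ratio `log₂ (dp_{Y|X}/dp_Y)(y|x)`, using the jointly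
measurable version of the kernel Radon–Nikodym derivative. -/
def llr (pX : Measure 𝒳) (κ : Kernel 𝒳 𝒴) [IsMarkovKernel κ] (z : 𝒳 × 𝒴) : ℝ :=
  Real.logb 2 (Kernel.rnDeriv κ (Kernel.const 𝒳 (pYout pX κ)) z.1 z.2).toReal

/-- The mutual information `I(X;Y) = D(p_{XY} ‖ p_X × p_Y)` in bits. -/
def mutInfoBits (pX : Measure 𝒳) (κ : Kernel 𝒳 𝒴) [IsMarkovKernel κ] : ℝ :=
  ∫ z, Real.logb 2 ((pXY pX κ).rnDeriv (pX.prod (pYout pX κ)) z).toReal ∂(pXY pX κ)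

/-- Singularity: the log-likelihood ratio `log₂ (dp_{Y|X}/dp_Y)(Y|X)` is `p_{XY}`-a.s. equal
to its conditional expectation given `Y`, i.e. it is a.s. a deterministic function of `Y`. -/
def Singular (pX : Measure 𝒳) (κ : Kernel 𝒳 𝒴) [IsMarkovKernel κ] : Prop :=
  llr pX κ =ᵐ[pXY pX κ]
    (pXY pX κ)[llr pX κ | MeasurableSpace.comap Prod.snd inferInstance]

/-- The target law of `(X^n, Y^n)`: the pair `(X^n, Y^n)` is i.i.d. with per-letter joint
law `p_{XY}`, viewed as a measure on `𝒳ⁿ × 𝒴ⁿ`. -/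
def targetJoint (pX : Measure 𝒳) (κ : Kernel 𝒳 𝒴) [IsMarkovKernel κ] (n : ℕ) :
    Measure ((Fin n → 𝒳) × (Fin n → 𝒴)) :=
  Measure.map (fun v => (fun i => (v i).1, fun i => (v i).2))
    (Measure.pi fun _ : Fin n => pXY pX κ)

/-- The `n`-letter minimum average rate `R_n` of exact channel synthesis: the infimum of
`(1/n) E[ℓ(f(X^n,U))]` over all common randomness `(𝒰, μU)`, (measurable) encoders `f` whose
range `f(·,u)` is prefix-free for each `u`, and (measurable) decoders `g`, such that with
`X^n ~ p_X^{⊗n}` independent of `U ~ μU` and `Y^n = g(f(X^n,U),U)`, the pair `(X^n,Y^n)` has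
the i.i.d. law `(p_X p_{Y|X})^{⊗n}`. -/
def Rn (pX : Measure 𝒳) (κ : Kernel 𝒳 𝒴) [IsMarkovKernel κ] (n : ℕ) : ℝ :=
  sInf {r : ℝ |
    ∃ (𝒰 : Type) (_ : MeasurableSpace 𝒰) (μU : Measure 𝒰) (_ : IsProbabilityMeasure μU)
      (f : (Fin n → 𝒳) → 𝒰 → List Bool) (g : List Bool → 𝒰 → (Fin n → 𝒴)),
      Measurable (fun p : (Fin n → 𝒳) × 𝒰 => f p.1 p.2) ∧
      Measurable (fun p : List Bool × 𝒰 => g p.1 p.2) ∧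
      (∀ (u : 𝒰) (x₁ x₂ : Fin n → 𝒳), (f x₁ u) <+: (f x₂ u) → f x₁ u = f x₂ u) ∧
      Measure.map (fun p : (Fin n → 𝒳) × 𝒰 => (p.1, g (f p.1 p.2) p.2))
          ((Measure.pi fun _ : Fin n => pX).prod μU) = targetJoint pX κ n ∧
      Integrable (fun p : (Fin n → 𝒳) × 𝒰 => ((f p.1 p.2).length : ℝ))
          ((Measure.pi fun _ : Fin n => pX).prod μU) ∧
      r = (1 / n : ℝ) * ∫ p, ((f p.1 p.2).length : ℝ)
            ∂((Measure.pi fun _ : Fin n => pX).prod μU)}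

set_option linter.unusedSectionVars false

/-! ### Prefix codes -/

lemma uniquelyDecodable_of_prefixFree {S : Set (List Bool)} (hnil : [] ∉ S)
    (h : ∀ a ∈ S, ∀ b ∈ S, a <+: b → a = b) : InformationTheory.UniquelyDecodable S := by
  intro L₁
  induction L₁ with
  | nil =>
    intro L₂ _ h2 hf
    cases L₂ with
    | nil => rfl
    | cons b L₂ =>
      simp only [List.flatten_nil, List.flatten_cons] at hf
      have : b = [] := by
        have := hf.symm
        simp only [List.append_eq_nil_iff] at this
        exact this.1
      exact absurd (this ▸ h2 b (by simp)) hnil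
  | cons a L₁ ih =>
    intro L₂ h1 h2 hf
    cases L₂ with
    | nil =>
      simp only [List.flatten_nil, List.flatten_cons, List.append_eq_nil_iff] at hf
      exact absurd (hf.1 ▸ h1 a (by simp)) hnil
    | cons b L₂ =>
      simp only [List.flatten_cons] at hf
      have hab : a = b := by
        have ha : a <+: a ++ L₁.flatten := List.prefix_append _ _
        have hb : b <+: a ++ L₁.flatten := hf ▸ List.prefix_append _ _
        rcases List.prefix_or_prefix_of_prefix ha hb with h' | h'
        · exact h a (h1 a (by simp)) b (h2 b (by simp)) h'
        · exact (h b (h2 b (by simp)) a (h1 a (by simp)) h').symm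
      subst hab
      rw [ih L₂ (fun w hw => h1 w (by simp [hw])) (fun w hw => h2 w (by simp [hw]))
        (List.append_cancel_left hf)]

/-- Kraft's inequality for a (possibly infinite) prefix-free set of binary strings. -/
lemma tsum_indicator_inv_two_pow_length_le_one {S : Set (List Bool)}
    (h : ∀ a ∈ S, ∀ b ∈ S, a <+: b → a = b) :
    ∑' s : List Bool, S.indicator (fun s => (2 : ℝ≥0∞)⁻¹ ^ s.length) s ≤ 1 := by
  classical
  rw [ENNReal.tsum_eq_iSup_sum]
  refine iSup_le fun T => ?_
  rw [← Finset.sum_filter_add_sum_filter_not T (· ∈ S),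
    Finset.sum_eq_zero (s := T.filter (· ∉ S)) (by
      intro s hs; simp [(Finset.mem_filter.1 hs).2]), add_zero]
  rw [Finset.sum_congr rfl (g := fun s => (2 : ℝ≥0∞)⁻¹ ^ s.length) (by
      intro s hs; simp [(Finset.mem_filter.1 hs).2])]
  set T' := T.filter (· ∈ S) with hT'
  have hsub : ∀ a ∈ T', a ∈ S := fun a ha => (Finset.mem_filter.1 ha).2
  by_cases hnil : [] ∈ T'
  · have : T' = {[]} := by
      ext a
      simp only [Finset.mem_singleton]
      refine ⟨fun ha => (h [] (hsub _ hnil) a (hsub _ ha) (List.nil_prefix)).symm, ?_⟩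
      rintro rfl; exact hnil
    simp [this]
  · have hud : InformationTheory.UniquelyDecodable (T' : Set (List Bool)) :=
      uniquelyDecodable_of_prefixFree (by simpa using hnil)
        (fun a ha b hb => h a (hsub a ha) b (hsub b hb))
    have hk := InformationTheory.kraft_mcmillan_inequality hud
    have h2 : ∑ s ∈ T', (2 : ℝ≥0∞)⁻¹ ^ s.length
        = ENNReal.ofReal (∑ w ∈ T', (1 / Fintype.card Bool : ℝ) ^ w.length) := by
      rw [ENNReal.ofReal_sum_of_nonneg (fun _ _ => by positivity)]
      refine Finset.sum_congr rfl fun s _ => ?_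
      rw [ENNReal.ofReal_pow (by positivity)]
      congr 1
      simp only [Fintype.card_bool, one_div]
      rw [ENNReal.ofReal_inv_of_pos (by norm_num)]
      norm_num
    rw [h2]
    exact ENNReal.ofReal_le_one.2 hk

/-- The number in `[0, 1)` whose binary expansion starts with the given string. -/
def binaryValue : List Bool → ℝ
  | [] => 0
  | b :: s => ((if b then 1 else 0) + binaryValue s) / 2

lemma binaryValue_nonneg (s : List Bool) : 0 ≤ binaryValue s := by
  induction s with
  | nil => simp [binaryValue]
  | cons b s ih => cases b <;> simp only [binaryValue] <;> norm_num <;> linarith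

lemma binaryValue_lt_one (s : List Bool) : binaryValue s < 1 := by
  induction s with
  | nil => simp [binaryValue]
  | cons b s ih => cases b <;> simp only [binaryValue] <;> norm_num <;> linarith

lemma binaryValue_append (s t : List Bool) :
    binaryValue (s ++ t) = binaryValue s + binaryValue t / 2 ^ s.length := by
  induction s with
  | nil => simp [binaryValue]
  | cons b s ih =>
    simp only [List.cons_append, binaryValue, ih, List.length_cons, pow_succ]
    field_simp
    ring

lemma exists_binaryValue_eq (l : ℕ) :
    ∀ a : ℕ, a < 2 ^ l → ∃ s : List Bool, s.length = l ∧ binaryValue s = a / 2 ^ l := by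
  induction l with
  | zero => intro a ha; exact ⟨[], by simp_all [binaryValue]⟩
  | succ l ih =>
    intro a ha
    rcases lt_or_ge a (2 ^ l) with h | h
    · obtain ⟨s, hs, hv⟩ := ih a h
      refine ⟨false :: s, by simp [hs], ?_⟩
      simp only [binaryValue, hv, pow_succ]
      field_simp
      simp
    · obtain ⟨s, hs, hv⟩ := ih (a - 2 ^ l) (by rw [pow_succ] at ha; omega)
      refine ⟨true :: s, by simp [hs], ?_⟩
      simp only [binaryValue, hv, pow_succ]
      push_cast [Nat.cast_sub h]
      field_simp
      simp

lemma exists_prefixCode_nat (p : ℕ → ℝ) (hp : ∀ i, 0 ≤ p i)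
    (hsum : ∀ n, ∑ i ∈ Finset.range n, p i ≤ 1) :
    ∃ c : ℕ → List Bool, (∀ i j, 0 < p i → 0 < p j → c i <+: c j → i = j) ∧
      ∀ i, 0 < p i → ((c i).length : ℝ) ≤ 2 - Real.logb 2 (p i) := by
  set F : ℕ → ℝ := fun n => ∑ i ∈ Finset.range n, p i with hF
  have hFm : Monotone F := monotone_nat_of_le_succ fun n => by
    simp only [hF, Finset.sum_range_succ]; linarith [hp n]
  have key : ∀ i, ∃ s : List Bool, 0 < p i → ((s.length : ℝ) ≤ 2 - Real.logb 2 (p i) ∧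
      F i ≤ binaryValue s ∧ binaryValue s + 1 / 2 ^ s.length ≤ F (i + 1)) := by
    intro i
    by_cases hi : 0 < p i
    swap
    · exact ⟨[], fun h => absurd h hi⟩
    have hi1 : p i ≤ 1 := by
      have := hsum (i + 1)
      rw [Finset.sum_range_succ] at this
      have := Finset.sum_nonneg (s := Finset.range i) (fun j _ => hp j)
      linarith
    have hlog : 0 ≤ - Real.logb 2 (p i) := by
      have := Real.logb_nonpos (b := 2) (by norm_num) hi.le hi1
      linarith
    set l := ⌈- Real.logb 2 (p i)⌉₊ + 1 with hl
    have hpl : 2 ≤ p i * 2 ^ l := by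
      have h1 : - Real.logb 2 (p i) ≤ (⌈- Real.logb 2 (p i)⌉₊ : ℝ) := Nat.le_ceil _
      have h2 : (p i)⁻¹ ≤ 2 ^ ⌈- Real.logb 2 (p i)⌉₊ := by
        rw [← Real.logb_inv] at h1
        have := (Real.logb_le_iff_le_rpow (b := 2) (by norm_num) (by positivity)).1 h1
        rw [Real.logb_inv] at this
        exact_mod_cast this
      rw [hl, pow_succ]
      have h3 : 1 ≤ p i * 2 ^ ⌈- Real.logb 2 (p i)⌉₊ := by
        have := mul_le_mul_of_nonneg_left h2 hi.le
        rwa [mul_inv_cancel₀ hi.ne'] at this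
      linarith
    have hF0 : 0 ≤ F i := Finset.sum_nonneg fun j _ => hp j
    have hFs : F (i + 1) = F i + p i := by simp [hF, Finset.sum_range_succ]
    have hceil : (⌈F i * 2 ^ l⌉₊ : ℝ) < F i * 2 ^ l + 1 := Nat.ceil_lt_add_one (by positivity)
    have hle : (⌈F i * 2 ^ l⌉₊ : ℝ) + 1 ≤ F (i + 1) * 2 ^ l := by
      rw [hFs, add_mul]; linarith
    have hpos : (0 : ℝ) < 2 ^ l := by positivity
    have hlt : ⌈F i * 2 ^ l⌉₊ < 2 ^ l := by
      have : (⌈F i * 2 ^ l⌉₊ : ℝ) + 1 ≤ 2 ^ l := by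
        have := mul_le_mul_of_nonneg_right (hsum (i + 1)) hpos.le
        linarith
      have h' : (⌈F i * 2 ^ l⌉₊ : ℝ) < 2 ^ l := by linarith
      exact_mod_cast h'
    obtain ⟨s, hs, hv⟩ := exists_binaryValue_eq l _ hlt
    refine ⟨s, fun _ => ⟨?_, ?_, ?_⟩⟩
    · rw [hs, hl]
      push_cast
      have := Nat.ceil_lt_add_one hlog
      linarith
    · rw [hv, le_div_iff₀ hpos]
      exact Nat.le_ceil _
    · rw [hv, hs, ← add_div, div_le_iff₀ hpos]
      exact hle
  choose c hc using key
  refine ⟨c, fun i j hi hj hij => ?_, fun i hi => (hc i hi).1⟩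
  obtain ⟨t, ht⟩ := hij
  obtain ⟨-, hi1, hi2⟩ := hc i hi
  obtain ⟨-, hj1, hj2⟩ := hc j hj
  have hval := binaryValue_append (c i) t
  rw [ht] at hval
  have h0 : 0 ≤ binaryValue t / 2 ^ (c i).length :=
    div_nonneg (binaryValue_nonneg t) (by positivity)
  have h1 : binaryValue t / 2 ^ (c i).length < 1 / 2 ^ (c i).length :=
    div_lt_div_of_pos_right (binaryValue_lt_one t) (by positivity)
  have h2 : (0 : ℝ) < 1 / 2 ^ (c j).length := by positivity
  rcases lt_trichotomy i j with h | h | h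
  · have := hFm (Nat.succ_le_of_lt h)
    simp only [Nat.succ_eq_add_one] at this
    linarith
  · exact h
  · have := hFm (Nat.succ_le_of_lt h)
    simp only [Nat.succ_eq_add_one] at this
    linarith

/-- A Shannon–Fano–Elias code for a subprobability mass function on a countable type. Indices
of zero mass share a codeword with an index of positive mass. -/
lemma exists_prefixCode {ι : Type*} [Denumerable ι] (p : ι → ℝ≥0∞) (hsum : ∑' i, p i = 1) :
    ∃ c : ι → List Bool, (∀ i j, c i <+: c j → c i = c j) ∧
      (∀ i j, p i ≠ 0 → p j ≠ 0 → c i = c j → i = j) ∧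
      ∀ i, p i ≠ 0 → ((c i).length : ℝ) ≤ 2 - Real.logb 2 (p i).toReal := by
  classical
  have hle : ∀ i, p i ≤ 1 := fun i => hsum ▸ ENNReal.le_tsum i
  have hfin : ∀ i, p i ≠ ∞ := fun i => ((hle i).trans_lt ENNReal.one_lt_top).ne
  let e : ι ≃ ℕ := Denumerable.eqv ι
  obtain ⟨c, hc1, hc2⟩ := exists_prefixCode_nat (fun n => (p (e.symm n)).toReal)
    (fun _ => ENNReal.toReal_nonneg) (by
      intro n
      rw [← ENNReal.toReal_sum (fun i _ => hfin _)]
      refine ENNReal.toReal_le_of_le_ofReal zero_le_one ?_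
      rw [ENNReal.ofReal_one, ← hsum, ← e.symm.tsum_eq]
      exact ENNReal.sum_le_tsum _)
  have hpos : ∀ i, p i ≠ 0 → 0 < (p (e.symm (e i))).toReal := fun i hi => by
    rw [e.symm_apply_apply]
    exact ENNReal.toReal_pos hi (hfin i)
  obtain ⟨i₀, hi₀⟩ : ∃ i, p i ≠ 0 := by
    by_contra! h
    simp [h] at hsum
  let r : ι → ι := fun i => if p i = 0 then i₀ else i
  have hr : ∀ i, p (r i) ≠ 0 := fun i => by
    by_cases h : p i = 0
    · simpa [r, h] using hi₀
    · simp [r, h]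
  have hr' : ∀ i, p i ≠ 0 → r i = i := fun i hi => by simp [r, hi]
  refine ⟨fun i => c (e (r i)), fun i j hij => ?_, fun i j hi hj hij => ?_, fun i hi => ?_⟩
  · beta_reduce at hij ⊢
    rw [hc1 _ _ (hpos _ (hr i)) (hpos _ (hr j)) hij]
  · beta_reduce at hij
    rw [hr' i hi, hr' j hj] at hij
    exact e.injective (hc1 _ _ (hpos i hi) (hpos j hj) (hij ▸ List.prefix_rfl))
  · beta_reduce
    rw [hr' i hi]
    simpa using hc2 (e i) (hpos i hi)

/-! ### Greedy rejection sampling -/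

lemma infinitePi_first_hit {Ω : ℕ → Type*} [∀ i, MeasurableSpace (Ω i)]
    (μ : ∀ i, Measure (Ω i)) [∀ i, IsProbabilityMeasure (μ i)] {A : ∀ i, Set (Ω i)}
    (hA : ∀ i, MeasurableSet (A i)) (i : ℕ) {C : Set (Ω i)} (hC : MeasurableSet C) :
    Measure.infinitePi μ {u | u i ∈ C ∧ ∀ j < i, u j ∉ A j}
      = (∏ j ∈ Finset.range i, μ j (A j)ᶜ) * μ i C := by
  classical
  let T : ∀ j, Set (Ω j) := Function.update (fun j => (A j)ᶜ) i C
  have hT : {u : ∀ i, Ω i | u i ∈ C ∧ ∀ j < i, u j ∉ A j}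
      = Set.pi ↑(Finset.range (i + 1)) T := by
    ext u
    simp only [Set.mem_ofPred_eq, Set.mem_pi, Finset.coe_range, Set.mem_Iio, Nat.lt_succ_iff]
    constructor
    · rintro ⟨h1, h2⟩ j hj
      rcases hj.lt_or_eq with h | rfl
      · simpa [T, h.ne] using h2 j h
      · simpa [T] using h1
    · intro h
      exact ⟨by simpa [T] using h i le_rfl, fun j hj => by simpa [T, hj.ne] using h j hj.le⟩
  have hTm : ∀ j, MeasurableSet (T j) := fun j => by
    by_cases h : j = i
    · subst h; simpa [T] using hC
    · simpa [T, h] using (hA j)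
  rw [hT, Measure.infinitePi_pi _ (fun j _ => hTm j), Finset.prod_range_succ]
  congr 1
  · refine Finset.prod_congr rfl fun j hj => ?_
    simp [T, (Finset.mem_range.1 hj).ne]
  · simp [T]

lemma exists_measurable_index {Ω ι : Type*} [MeasurableSpace Ω] [Countable ι] [Nonempty ι]
    [MeasurableSpace ι] (H : ι → Set Ω) (hH : ∀ i, MeasurableSet (H i))
    (hdisj : ∀ i j ω, ω ∈ H i → ω ∈ H j → i = j) :
    ∃ I : Ω → ι, Measurable I ∧ ∀ i, ∀ ω ∈ H i, I ω = i := by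
  obtain ⟨f, hf, h⟩ := exists_measurable_piecewise H hH (fun i _ => i)
    (fun i => measurable_const) (fun i j hij ω hω => absurd (hdisj i j ω hω.1 hω.2) hij)
  exact ⟨f, hf, fun i ω hω => h i hω⟩

section Sampler

variable {A B : Type*} [MeasurableSpace A] [MeasurableSpace B]
  {ν : ℕ → Measure B} {α : ℕ → A → B → ℝ≥0∞}

/-- The probability that none of the first `j` proposals is accepted. -/
def survival (ν : ℕ → Measure B) (α : ℕ → A → B → ℝ≥0∞) (j : ℕ) (x : A) : ℝ≥0∞ :=
  1 - 2⁻¹ * ∑ i ∈ Finset.range j, ∫⁻ y, α i x y ∂ν i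

/-- The pairs of a proposal and a uniform threshold for which the proposal `j` is accepted. -/
def acceptSet (ν : ℕ → Measure B) (α : ℕ → A → B → ℝ≥0∞) (j : ℕ) (x : A) :
    Set (B × unitInterval) :=
  {p | (p.2 : ℝ) ≤ (2⁻¹ * α j x p.1 / survival ν α j x).toReal}

/-- In one round of proposals, the proposal `j` is the first accepted one. -/
def firstAccept (ν : ℕ → Measure B) (α : ℕ → A → B → ℝ≥0∞) (j : ℕ) (x : A) :
    Set (ℕ → B × unitInterval) :=
  {ω | ω j ∈ acceptSet ν α j x ∧ ∀ i < j, ω i ∉ acceptSet ν α i x}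

/-- Some proposal of a round is accepted. -/
def roundSuccess (ν : ℕ → Measure B) (α : ℕ → A → B → ℝ≥0∞) (x : A) :
    Set (ℕ → B × unitInterval) :=
  {ω | ∃ j, ω j ∈ acceptSet ν α j x}

lemma measurable_survival [∀ j, SFinite (ν j)] (hα : ∀ j, Measurable (Function.uncurry (α j)))
    (j : ℕ) : Measurable (survival ν α j) := by
  unfold survival
  have : ∀ i, Measurable fun x => ∫⁻ y, α i x y ∂ν i := fun i => (hα i).lintegral_prod_right'
  fun_prop

lemma measurableSet_acceptSet_prod [∀ j, SFinite (ν j)]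
    (hα : ∀ j, Measurable (Function.uncurry (α j))) (j : ℕ) :
    MeasurableSet {p : A × (B × unitInterval) | p.2 ∈ acceptSet ν α j p.1} := by
  have h1 := measurable_survival (ν := ν) hα j
  have h2 : Measurable fun p : A × (B × unitInterval) => α j p.1 p.2.1 :=
    (hα j).comp (measurable_fst.prodMk (measurable_fst.comp measurable_snd))
  exact measurableSet_le (f := fun p : A × (B × unitInterval) => (p.2.2 : ℝ))
    (g := fun p => (2⁻¹ * α j p.1 p.2.1 / survival ν α j p.1).toReal)
    (measurable_subtype_coe.comp (measurable_snd.comp measurable_snd))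
    ((h2.const_mul _).div (h1.comp measurable_fst)).ennreal_toReal

lemma measurableSet_acceptSet [∀ j, SFinite (ν j)]
    (hα : ∀ j, Measurable (Function.uncurry (α j))) (j : ℕ) (x : A) :
    MeasurableSet (acceptSet ν α j x) :=
  measurable_prodMk_left (measurableSet_acceptSet_prod hα j)

lemma firstAccept_subset_roundSuccess (j : ℕ) (x : A) :
    firstAccept ν α j x ⊆ roundSuccess ν α x := fun _ h => ⟨j, h.1⟩

lemma firstAccept_unique {i j : ℕ} {x : A} {ω : ℕ → B × unitInterval}
    (hi : ω ∈ firstAccept ν α i x) (hj : ω ∈ firstAccept ν α j x) : i = j := by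
  rcases lt_trichotomy i j with h | h | h
  · exact absurd hi.1 (hj.2 i h)
  · exact h
  · exact absurd hj.1 (hi.2 j h)

lemma roundSuccess_eq_iUnion (x : A) : roundSuccess ν α x = ⋃ j, firstAccept ν α j x := by
  classical
  ext ω
  simp only [Set.mem_iUnion]
  refine ⟨fun h => ?_, fun ⟨j, hj⟩ => firstAccept_subset_roundSuccess j x hj⟩
  have h' : ∃ j, ω j ∈ acceptSet ν α j x := h
  exact ⟨Nat.find h', Nat.find_spec h', fun i hi => Nat.find_min h' hi⟩

lemma measurableSet_firstAccept_prod [∀ j, SFinite (ν j)]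
    (hα : ∀ j, Measurable (Function.uncurry (α j))) (j : ℕ) :
    MeasurableSet {p : A × (ℕ → B × unitInterval) | p.2 ∈ firstAccept ν α j p.1} := by
  have h : ∀ i, MeasurableSet {p : A × (ℕ → B × unitInterval) | p.2 i ∈ acceptSet ν α i p.1} :=
    fun i => (measurableSet_acceptSet_prod hα i).preimage
      (measurable_fst.prodMk ((measurable_pi_apply i).comp measurable_snd))
  have : {p : A × (ℕ → B × unitInterval) | p.2 ∈ firstAccept ν α j p.1}
      = {p | p.2 j ∈ acceptSet ν α j p.1} ∩
        ⋂ i ∈ Finset.range j, {p | p.2 i ∈ acceptSet ν α i p.1}ᶜ := by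
    ext p
    simp [firstAccept]
  rw [this]
  exact (h j).inter (Finset.measurableSet_biInter _ fun i _ => (h i).compl)

lemma measurableSet_roundSuccess_prod [∀ j, SFinite (ν j)]
    (hα : ∀ j, Measurable (Function.uncurry (α j))) :
    MeasurableSet {p : A × (ℕ → B × unitInterval) | p.2 ∈ roundSuccess ν α p.1} := by
  have : {p : A × (ℕ → B × unitInterval) | p.2 ∈ roundSuccess ν α p.1}
      = ⋃ j, {p | p.2 ∈ firstAccept ν α j p.1} := by
    ext p
    simp [roundSuccess_eq_iUnion]
  rw [this]
  exact MeasurableSet.iUnion fun j => measurableSet_firstAccept_prod hα j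

section Laws

variable [∀ j, IsProbabilityMeasure (ν j)] {x : A}

lemma sum_le_one_of_tsum_eq_one (hx : ∑' j, ∫⁻ y, α j x y ∂ν j = 1) (j : ℕ) :
    ∑ i ∈ Finset.range j, ∫⁻ y, α i x y ∂ν i ≤ 1 := hx ▸ ENNReal.sum_le_tsum _

lemma half_le_survival (hx : ∑' j, ∫⁻ y, α j x y ∂ν j = 1) (j : ℕ) :
    2⁻¹ ≤ survival ν α j x := by
  unfold survival
  refine ENNReal.le_sub_of_add_le_right ?_ ?_
  · exact (ENNReal.mul_lt_top (by simp)
      ((sum_le_one_of_tsum_eq_one hx j).trans_lt ENNReal.one_lt_top)).ne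
  · calc 2⁻¹ + 2⁻¹ * ∑ i ∈ Finset.range j, ∫⁻ y, α i x y ∂ν i ≤ 2⁻¹ + 2⁻¹ * 1 := by
          gcongr; exact sum_le_one_of_tsum_eq_one hx j
      _ = 1 := by rw [mul_one, ENNReal.inv_two_add_inv_two]

lemma survival_ne_top (j : ℕ) : survival ν α j x ≠ ∞ :=
  (tsub_le_self.trans_lt ENNReal.one_lt_top).ne

lemma survival_ne_zero (hx : ∑' j, ∫⁻ y, α j x y ∂ν j = 1) (j : ℕ) : survival ν α j x ≠ 0 :=
  fun h => by simpa [h] using half_le_survival hx j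

lemma survival_succ (j : ℕ) :
    survival ν α (j + 1) x = survival ν α j x - 2⁻¹ * ∫⁻ y, α j x y ∂ν j := by
  unfold survival
  rw [Finset.sum_range_succ, mul_add, tsub_add_eq_tsub_tsub]

lemma measure_acceptSet_inter (hα : ∀ j, Measurable (Function.uncurry (α j)))
    (hα1 : ∀ j x y, α j x y ≤ 1) (hx : ∑' j, ∫⁻ y, α j x y ∂ν j = 1) (j : ℕ) {S : Set B}
    (hS : MeasurableSet S) :
    ((ν j).prod volume) (acceptSet ν α j x ∩ Prod.fst ⁻¹' S)
      = 2⁻¹ * (∫⁻ y in S, α j x y ∂ν j) / survival ν α j x := by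
  have hαx : Measurable (α j x) := (hα j).comp measurable_prodMk_left
  rw [Measure.prod_apply ((measurableSet_acceptSet hα j x).inter (measurable_fst hS))]
  have : ∀ y, volume (Prod.mk y ⁻¹' (acceptSet ν α j x ∩ Prod.fst ⁻¹' S))
      = S.indicator (fun y => 2⁻¹ * (survival ν α j x)⁻¹ * α j x y) y := by
    intro y
    by_cases hy : y ∈ S
    · rw [Set.indicator_of_mem hy]
      set c := 2⁻¹ * α j x y / survival ν α j x with hc
      have hc1 : c ≤ 1 := by
        rw [hc, ENNReal.div_le_iff (survival_ne_zero hx j) (survival_ne_top j), one_mul]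
        refine le_trans ?_ (half_le_survival hx j)
        calc 2⁻¹ * α j x y ≤ 2⁻¹ * 1 := by gcongr; exact hα1 j x y
          _ = 2⁻¹ := mul_one _
      have hctop : c ≠ ∞ := (hc1.trans_lt ENNReal.one_lt_top).ne
      have hmem : c.toReal ∈ Set.Icc (0 : ℝ) 1 :=
        ⟨ENNReal.toReal_nonneg, ENNReal.toReal_le_of_le_ofReal zero_le_one (by simpa using hc1)⟩
      have : Prod.mk y ⁻¹' (acceptSet ν α j x ∩ Prod.fst ⁻¹' S)
          = Set.Iic (⟨c.toReal, hmem⟩ : unitInterval) := by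
        ext v
        simp only [acceptSet, Set.preimage_inter, Set.mem_inter_iff, Set.mem_preimage,
          Set.mem_ofPred_eq, hy, and_true, Set.mem_Iic, ← hc]
        rfl
      rw [this, unitInterval.volume_Iic]
      simp only
      rw [ENNReal.ofReal_toReal hctop, hc, div_eq_mul_inv]
      ring
    · rw [Set.indicator_of_notMem hy]
      have : Prod.mk y ⁻¹' (acceptSet ν α j x ∩ Prod.fst ⁻¹' S) = ∅ := by
        ext v; simp [hy]
      rw [this, measure_empty]
  simp_rw [this]
  rw [lintegral_indicator hS, lintegral_const_mul _ hαx, div_eq_mul_inv]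
  ring

lemma prod_measure_compl_acceptSet (hα : ∀ j, Measurable (Function.uncurry (α j)))
    (hα1 : ∀ j x y, α j x y ≤ 1) (hx : ∑' j, ∫⁻ y, α j x y ∂ν j = 1) (j : ℕ) :
    ∏ i ∈ Finset.range j, ((ν i).prod volume) (acceptSet ν α i x)ᶜ = survival ν α j x := by
  induction j with
  | zero => simp [survival]
  | succ j ih =>
    have h := measure_acceptSet_inter hα hα1 hx j (S := Set.univ) MeasurableSet.univ
    rw [Set.preimage_univ, Set.inter_univ, Measure.restrict_univ] at h
    rw [Finset.prod_range_succ, ih, prob_compl_eq_one_sub (measurableSet_acceptSet hα j x), h,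
      survival_succ, ENNReal.mul_sub (fun _ _ => survival_ne_top j), mul_one,
      ENNReal.mul_div_cancel (survival_ne_zero hx j) (survival_ne_top j)]

lemma measure_firstAccept (hα : ∀ j, Measurable (Function.uncurry (α j)))
    (hα1 : ∀ j x y, α j x y ≤ 1) (hx : ∑' j, ∫⁻ y, α j x y ∂ν j = 1) (j : ℕ) {S : Set B}
    (hS : MeasurableSet S) :
    Measure.infinitePi (fun j => (ν j).prod (volume : Measure unitInterval))
      (firstAccept ν α j x ∩ {ω | (ω j).1 ∈ S}) = 2⁻¹ * ∫⁻ y in S, α j x y ∂ν j := by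
  have : firstAccept ν α j x ∩ {ω | (ω j).1 ∈ S}
      = {ω | ω j ∈ acceptSet ν α j x ∩ Prod.fst ⁻¹' S ∧ ∀ i < j, ω i ∉ acceptSet ν α i x} := by
    ext ω
    simp only [firstAccept, Set.mem_inter_iff, Set.mem_ofPred_eq, Set.mem_preimage]
    tauto
  rw [this, infinitePi_first_hit _ (fun i => measurableSet_acceptSet hα i x) j
    ((measurableSet_acceptSet hα j x).inter (measurable_fst hS)),
    prod_measure_compl_acceptSet hα hα1 hx, measure_acceptSet_inter hα hα1 hx j hS,
    ENNReal.mul_div_cancel (survival_ne_zero hx j) (survival_ne_top j)]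

lemma measure_roundSuccess (hα : ∀ j, Measurable (Function.uncurry (α j)))
    (hα1 : ∀ j x y, α j x y ≤ 1) (hx : ∑' j, ∫⁻ y, α j x y ∂ν j = 1) :
    Measure.infinitePi (fun j => (ν j).prod (volume : Measure unitInterval))
      (roundSuccess ν α x) = 2⁻¹ := by
  rw [roundSuccess_eq_iUnion, measure_iUnion]
  · have : ∀ j, Measure.infinitePi (fun j => (ν j).prod (volume : Measure unitInterval))
        (firstAccept ν α j x) = 2⁻¹ * ∫⁻ y, α j x y ∂ν j := fun j => by
      simpa using measure_firstAccept hα hα1 hx j (S := Set.univ) MeasurableSet.univ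
    simp_rw [this, ENNReal.tsum_mul_left, hx, mul_one]
  · intro i j hij
    rw [Function.onFun, Set.disjoint_left]
    exact fun ω hi hj => hij (firstAccept_unique hi hj)
  · exact fun j => measurable_prodMk_left (measurableSet_firstAccept_prod hα j)

/-- The first successful round is `t`, and its first accepted proposal is `j`. -/
def sampleHit (ν : ℕ → Measure B) (α : ℕ → A → B → ℝ≥0∞) (i : ℕ × ℕ) (x : A) :
    Set (ℕ → ℕ → B × unitInterval) :=
  {u | u i.1 ∈ firstAccept ν α i.2 x ∧ ∀ s < i.1, u s ∉ roundSuccess ν α x}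

lemma measure_sampleHit (hα : ∀ j, Measurable (Function.uncurry (α j)))
    (hα1 : ∀ j x y, α j x y ≤ 1) (hx : ∑' j, ∫⁻ y, α j x y ∂ν j = 1) (i : ℕ × ℕ) {S : Set B}
    (hS : MeasurableSet S) :
    Measure.infinitePi (fun _ : ℕ =>
        Measure.infinitePi (fun j => (ν j).prod (volume : Measure unitInterval)))
      (sampleHit ν α i x ∩ {u | (u i.1 i.2).1 ∈ S})
      = 2⁻¹ ^ (i.1 + 1) * ∫⁻ y in S, α i.2 x y ∂ν i.2 := by
  have hr : MeasurableSet (roundSuccess ν α x) :=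
    measurable_prodMk_left (measurableSet_roundSuccess_prod hα)
  have : sampleHit ν α i x ∩ {u | (u i.1 i.2).1 ∈ S}
      = {u | u i.1 ∈ firstAccept ν α i.2 x ∩ {ω | (ω i.2).1 ∈ S} ∧
          ∀ s < i.1, u s ∉ roundSuccess ν α x} := by
    ext u
    simp only [sampleHit, Set.mem_inter_iff, Set.mem_ofPred_eq]
    tauto
  rw [this, infinitePi_first_hit _ (fun _ => hr) i.1, measure_firstAccept hα hα1 hx _ hS,
    prob_compl_eq_one_sub hr, measure_roundSuccess hα hα1 hx, Finset.prod_const,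
    Finset.card_range, ENNReal.one_sub_inv_two, pow_succ, mul_assoc]
  refine (measurable_prodMk_left (measurableSet_firstAccept_prod hα i.2)).inter ?_
  exact hS.preimage (measurable_fst.comp (measurable_pi_apply i.2))

lemma sampleHit_unique {i j : ℕ × ℕ} {u : ℕ → ℕ → B × unitInterval}
    (hi : u ∈ sampleHit ν α i x) (hj : u ∈ sampleHit ν α j x) : i = j := by
  have h1 : i.1 = j.1 := by
    rcases lt_trichotomy i.1 j.1 with h | h | h
    · exact absurd (firstAccept_subset_roundSuccess _ _ hi.1) (hj.2 _ h)
    · exact h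
    · exact absurd (firstAccept_subset_roundSuccess _ _ hj.1) (hi.2 _ h)
  exact Prod.ext h1 (firstAccept_unique (h1 ▸ hi.1) hj.1)

lemma measurableSet_sampleHit_prod (hα : ∀ j, Measurable (Function.uncurry (α j)))
    (i : ℕ × ℕ) :
    MeasurableSet {p : A × (ℕ → ℕ → B × unitInterval) | p.2 ∈ sampleHit ν α i p.1} := by
  have hm : ∀ s : ℕ, Measurable fun p : A × (ℕ → ℕ → B × unitInterval) => (p.1, p.2 s) :=
    fun s => measurable_fst.prodMk ((measurable_pi_apply s).comp measurable_snd)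
  have : {p : A × (ℕ → ℕ → B × unitInterval) | p.2 ∈ sampleHit ν α i p.1}
      = {p | p.2 i.1 ∈ firstAccept ν α i.2 p.1} ∩
        ⋂ s ∈ Finset.range i.1, {p | p.2 s ∈ roundSuccess ν α p.1}ᶜ := by
    ext p
    simp [sampleHit]
  rw [this]
  exact ((measurableSet_firstAccept_prod hα i.2).preimage (hm i.1)).inter
    (Finset.measurableSet_biInter _ fun s _ =>
      ((measurableSet_roundSuccess_prod hα).preimage (hm s)).compl)

end Laws

end Sampler

/-- Common randomness `U` and an index `I` computed from the source and `U` such that the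
`I`-th proposal, a function of `I` and `U` only, has the required joint law with the source;
the index is essentially distributed according to the weights. -/
theorem exists_sampler {A B : Type} [MeasurableSpace A] [MeasurableSpace B]
    (μ : Measure A) [IsProbabilityMeasure μ] (Q : Measure B) [IsProbabilityMeasure Q]
    {d : A → B → ℝ≥0∞} (hd : Measurable (Function.uncurry d))
    (hd1 : ∀ᵐ x ∂μ, ∫⁻ y, d x y ∂Q = 1)
    {w : ℕ → B → ℝ≥0∞} (hw : ∀ j, Measurable (w j)) (hw1 : ∀ᵐ y ∂Q, ∑' j, w j y = 1)
    (ν : ℕ → Measure B) [∀ j, IsProbabilityMeasure (ν j)] {α : ℕ → A → B → ℝ≥0∞}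
    (hα : ∀ j, Measurable (Function.uncurry (α j))) (hα1 : ∀ j x y, α j x y ≤ 1)
    (hαw : ∀ j x (S : Set B), MeasurableSet S →
      ∫⁻ y in S, α j x y ∂ν j = ∫⁻ y in S, w j y * d x y ∂Q) :
    ∃ (𝒰 : Type) (_ : MeasurableSpace 𝒰) (μU : Measure 𝒰) (_ : IsProbabilityMeasure μU)
      (I : A × 𝒰 → ℕ × ℕ) (Y : ℕ × ℕ → 𝒰 → B), Measurable I ∧ (∀ i, Measurable (Y i)) ∧
      ∀ i (Z : Set (A × B)), MeasurableSet Z →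
        2⁻¹ ^ (i.1 + 1) * ∫⁻ z in Z, w i.2 z.2 ∂((μ.prod Q).withDensity (Function.uncurry d))
          ≤ (μ.prod μU) {p | I p = i ∧ (p.1, Y i p.2) ∈ Z} := by
  obtain ⟨I, hI, hIh⟩ := exists_measurable_index
    (fun i => {p : A × (ℕ → ℕ → B × unitInterval) | p.2 ∈ sampleHit ν α i p.1})
    (fun i => measurableSet_sampleHit_prod hα i)
    (fun i j p hi hj => sampleHit_unique hi hj)
  have hY : ∀ i : ℕ × ℕ, Measurable fun u : ℕ → ℕ → B × unitInterval => (u i.1 i.2).1 :=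
    fun i => by fun_prop
  refine ⟨ℕ → ℕ → B × unitInterval, inferInstance, Measure.infinitePi (fun _ : ℕ =>
      Measure.infinitePi (fun j => (ν j).prod (volume : Measure unitInterval))), inferInstance,
    I, fun i u => (u i.1 i.2).1, hI, hY, fun i Z hZ => ?_⟩
  have hx : ∀ᵐ x ∂μ, ∑' j, ∫⁻ y, α j x y ∂ν j = 1 := by
    filter_upwards [hd1] with x hx
    have h1 : ∀ j, ∫⁻ y, α j x y ∂ν j = ∫⁻ y, w j y * d x y ∂Q := fun j => by
      simpa using hαw j x Set.univ MeasurableSet.univ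
    have hdx : Measurable (d x) := hd.comp measurable_prodMk_left
    simp_rw [h1]
    rw [← lintegral_tsum (f := fun j y => w j y * d x y)
      (fun j => ((hw j).mul hdx).aemeasurable), ← hx]
    refine lintegral_congr_ae ?_
    filter_upwards [hw1] with y hy
    rw [ENNReal.tsum_mul_right, hy, one_mul]
  have hsub : {p : A × (ℕ → ℕ → B × unitInterval) | p.2 ∈ sampleHit ν α i p.1 ∧
      (p.1, (p.2 i.1 i.2).1) ∈ Z} ⊆ {p | I p = i ∧ (p.1, (p.2 i.1 i.2).1) ∈ Z} :=
    fun p hp => ⟨hIh i p hp.1, hp.2⟩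
  refine le_trans (le_of_eq ?_) (measure_mono hsub)
  have hmeas : MeasurableSet {p : A × (ℕ → ℕ → B × unitInterval) | p.2 ∈ sampleHit ν α i p.1 ∧
      (p.1, (p.2 i.1 i.2).1) ∈ Z} :=
    (measurableSet_sampleHit_prod hα i).inter
      (hZ.preimage (measurable_fst.prodMk ((hY i).comp measurable_snd)))
  have hwm : Measurable fun z : A × B => w i.2 z.2 := (hw i.2).comp measurable_snd
  rw [Measure.prod_apply hmeas, setLIntegral_withDensity_eq_setLIntegral_mul _ hd hwm hZ,
    ← lintegral_indicator hZ, lintegral_prod _ ((hd.mul hwm).indicator hZ).aemeasurable,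
    ← lintegral_const_mul' _ _ (by simp)]
  refine lintegral_congr_ae ?_
  filter_upwards [hx] with x hx
  have hZx : MeasurableSet (Prod.mk x ⁻¹' Z) := measurable_prodMk_left hZ
  have := measure_sampleHit hα hα1 hx i hZx
  rw [hαw _ _ _ hZx] at this
  refine Eq.trans ?_ this.symm
  congr 1
  rw [← lintegral_indicator hZx]
  refine lintegral_congr fun y => ?_
  by_cases hy : (x, y) ∈ Z
  · simp [hy, mul_comm, Function.uncurry]
  · simp [hy]

section Coding

variable {A B : Type} [MeasurableSpace A] [MeasurableSpace B]

lemma exists_code_of_sampler {𝒰 : Type} [MeasurableSpace 𝒰] {μ : Measure A}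
    [IsProbabilityMeasure μ] {μU : Measure 𝒰} [IsProbabilityMeasure μU]
    {P : Measure (A × B)} [IsProbabilityMeasure P] {I : A × 𝒰 → ℕ × ℕ} {Y : ℕ × ℕ → 𝒰 → B}
    (hI : Measurable I) (hY : ∀ i, Measurable (Y i)) {W : ℕ × ℕ → Measure (A × B)}
    (hW : ∀ i Z, MeasurableSet Z → W i Z ≤ (μ.prod μU) {p | I p = i ∧ (p.1, Y i p.2) ∈ Z})
    (hWP : ∀ Z, MeasurableSet Z → ∑' i, W i Z = P Z) :
    ∃ (f : A → 𝒰 → List Bool) (g : List Bool → 𝒰 → B),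
      Measurable (fun p : A × 𝒰 => f p.1 p.2) ∧
      Measurable (fun p : List Bool × 𝒰 => g p.1 p.2) ∧
      (∀ (u : 𝒰) (x₁ x₂ : A), (f x₁ u) <+: (f x₂ u) → f x₁ u = f x₂ u) ∧
      Measure.map (fun p : A × 𝒰 => (p.1, g (f p.1 p.2) p.2)) (μ.prod μU) = P ∧
      ∫⁻ p, ((f p.1 p.2).length : ℝ≥0∞) ∂(μ.prod μU)
        ≤ ∑' i, W i Set.univ * ENNReal.ofReal (2 - Real.logb 2 (W i Set.univ).toReal) := by
  classical
  have hp1 : ∑' i, W i Set.univ = 1 := by rw [hWP _ MeasurableSet.univ, measure_univ]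
  obtain ⟨c, hc, hcinj, hclen⟩ := exists_prefixCode (fun i => W i Set.univ) hp1
  let dec : List Bool → ℕ × ℕ := fun s =>
    if h : ∃ i, W i Set.univ ≠ 0 ∧ c i = s then h.choose else (0, 0)
  have hdec : ∀ i, W i Set.univ ≠ 0 → dec (c i) = i := fun i hi => by
    have h : ∃ k, W k Set.univ ≠ 0 ∧ c k = c i := ⟨i, hi, rfl⟩
    simp only [dec, dif_pos h]
    exact hcinj _ _ h.choose_spec.1 hi h.choose_spec.2
  have hf : Measurable fun p : A × 𝒰 => c (I p) := (measurable_of_countable c).comp hI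
  have hg : Measurable fun p : List Bool × 𝒰 => Y (dec p.1) p.2 :=
    measurable_from_prod_countable_right fun s => hY (dec s)
  have hI' : ∀ i, MeasurableSet (I ⁻¹' {i}) := fun i => hI (measurableSet_singleton i)
  have hdisj : Pairwise (Function.onFun Disjoint fun i => I ⁻¹' {i}) := fun i j hij =>
    Disjoint.preimage _ (Set.disjoint_singleton.2 hij)
  refine ⟨fun x u => c (I (x, u)), fun s u => Y (dec s) u, hf, hg, fun u x₁ x₂ => hc _ _,
    ?_, ?_⟩
  · have hm : Measurable fun p : A × 𝒰 => (p.1, Y (dec (c (I p))) p.2) :=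
      measurable_fst.prodMk (hg.comp (hf.prodMk measurable_snd))
    have : IsProbabilityMeasure (Measure.map (fun p : A × 𝒰 => (p.1, Y (dec (c (I p))) p.2))
      (μ.prod μU)) := Measure.isProbabilityMeasure_map hm.aemeasurable
    refine (Measure.eq_of_le_of_isProbabilityMeasure (Measure.le_iff.2 fun Z hZ => ?_)).symm
    rw [Measure.map_apply hm hZ, ← hWP Z hZ]
    have hcov : (fun p : A × 𝒰 => (p.1, Y (dec (c (I p))) p.2)) ⁻¹' Z
        = ⋃ i, (I ⁻¹' {i}) ∩ (fun p : A × 𝒰 => (p.1, Y (dec (c (I p))) p.2)) ⁻¹' Z := by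
      ext p; simp
    rw [hcov, measure_iUnion (fun i j hij => (hdisj hij).mono Set.inter_subset_left
      Set.inter_subset_left) fun i => (hI' i).inter (hm hZ)]
    refine ENNReal.tsum_le_tsum fun i => ?_
    by_cases hi : W i Set.univ = 0
    · exact (measure_mono (Set.subset_univ Z)).trans (hi.le.trans zero_le)
    · refine (hW i Z hZ).trans (measure_mono fun p hp => ?_)
      obtain ⟨rfl, hp2⟩ := hp
      refine ⟨rfl, ?_⟩
      simpa [hdec _ hi] using hp2
  · have hlaw : ∀ i, (μ.prod μU) (I ⁻¹' {i}) = W i Set.univ := by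
      have hle : ∀ i, W i Set.univ ≤ (μ.prod μU) (I ⁻¹' {i}) := fun i => by
        simpa [Set.preimage] using hW i Set.univ MeasurableSet.univ
      have hsum : ∑' i, (μ.prod μU) (I ⁻¹' {i}) = 1 := by
        have hU : ⋃ i, I ⁻¹' {i} = Set.univ := by ext; simp
        rw [← measure_iUnion hdisj hI', hU, measure_univ]
      intro i
      refine le_antisymm (le_of_not_gt fun hlt => ?_) (hle i)
      have := ENNReal.tsum_lt_tsum (hp1.trans_ne ENNReal.one_ne_top) hle hlt
      rw [hp1, hsum] at this
      exact lt_irrefl _ this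
    have h1 : ∫⁻ p, ((c (I p)).length : ℝ≥0∞) ∂(μ.prod μU)
        = ∑' i, ((c i).length : ℝ≥0∞) * W i Set.univ := by
      rw [← lintegral_map (f := fun i => ((c i).length : ℝ≥0∞)) (measurable_of_countable _) hI,
        lintegral_countable']
      refine tsum_congr fun i => ?_
      rw [Measure.map_apply hI (measurableSet_singleton i), hlaw]
    refine h1.le.trans (ENNReal.tsum_le_tsum fun i => ?_)
    by_cases hi : W i Set.univ = 0
    · simp [hi]
    · rw [mul_comm]
      gcongr
      rw [← ENNReal.ofReal_natCast]
      exact ENNReal.ofReal_le_ofReal (hclen i hi)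

end Coding

section Buckets

variable {A B : Type} [MeasurableSpace A] [MeasurableSpace B]

/-- The number of candidate proposals for the points of level `k`. -/
def bucketCount (Q : Measure B) (κ : B → ℕ) (k : ℕ) : ℕ :=
  ⌈2 ^ (k + 1) * (Q (κ ⁻¹' {k})).toReal⌉₊

/-- The weight of candidate `j = pair k m`: level `k` is split evenly among its candidates. -/
def bucketWeight (Q : Measure B) (κ : B → ℕ) (j : ℕ) (y : B) : ℝ≥0∞ :=
  if κ y = j.unpair.1 ∧ j.unpair.2 < bucketCount Q κ j.unpair.1 then
    (bucketCount Q κ j.unpair.1 : ℝ≥0∞)⁻¹ else 0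

open Classical in
/-- The law of candidate `j = pair k m`: the output law conditioned on level `k`. -/
def bucketLaw (Q : Measure B) (κ : B → ℕ) (j : ℕ) : Measure B :=
  if Q (κ ⁻¹' {j.unpair.1}) = 0 then Q else Q[|κ ⁻¹' {j.unpair.1}]

variable {Q : Measure B} [IsProbabilityMeasure Q] {κ : B → ℕ}

instance isProbabilityMeasure_bucketLaw (j : ℕ) : IsProbabilityMeasure (bucketLaw Q κ j) := by
  unfold bucketLaw
  split_ifs with h
  · infer_instance
  · exact cond_isProbabilityMeasure h

lemma le_bucketCount (k : ℕ) :
    2 ^ (k + 1) * Q (κ ⁻¹' {k}) ≤ (bucketCount Q κ k : ℝ≥0∞) := by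
  have h := Nat.le_ceil ((2 : ℝ) ^ (k + 1) * (Q (κ ⁻¹' {k})).toReal)
  have := ENNReal.ofReal_le_ofReal h
  rw [ENNReal.ofReal_mul (by positivity), ENNReal.ofReal_toReal (measure_ne_top _ _),
    ENNReal.ofReal_natCast, ENNReal.ofReal_pow (by norm_num)] at this
  simpa [bucketCount] using this

lemma bucketCount_ne_zero {k : ℕ} (h : Q (κ ⁻¹' {k}) ≠ 0) : bucketCount Q κ k ≠ 0 := by
  intro h0
  have := le_bucketCount (Q := Q) (κ := κ) k
  rw [h0] at this
  simp [h] at this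

lemma bucketCount_eq_zero {k : ℕ} (h : Q (κ ⁻¹' {k}) = 0) : bucketCount Q κ k = 0 := by
  simp [bucketCount, h]

lemma measurable_bucketWeight (hκ : Measurable κ) (j : ℕ) : Measurable (bucketWeight Q κ j) := by
  have : MeasurableSet {y | κ y = j.unpair.1 ∧ j.unpair.2 < bucketCount Q κ j.unpair.1} :=
    (hκ (measurableSet_singleton j.unpair.1)).inter (MeasurableSet.const _)
  exact Measurable.ite this measurable_const measurable_const

lemma sum_ite_lt_inv {N : ℕ} (h : N ≠ 0) :
    ∑' m : ℕ, (if m < N then (N : ℝ≥0∞)⁻¹ else 0) = 1 := by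
  rw [tsum_eq_sum (s := Finset.range N) (by simp +contextual)]
  rw [Finset.sum_congr rfl fun m hm => if_pos (Finset.mem_range.1 hm)]
  simp only [Finset.sum_const, Finset.card_range, nsmul_eq_mul]
  exact ENNReal.mul_inv_cancel (by simpa using h) (by simp)

lemma tsum_unpair (F : ℕ → ℕ → ℝ≥0∞) :
    ∑' j : ℕ, F j.unpair.1 j.unpair.2 = ∑' k, ∑' m, F k m := by
  rw [← ENNReal.tsum_prod, ← Nat.pairEquiv.symm.tsum_eq (fun p : ℕ × ℕ => F p.1 p.2)]
  rfl

lemma tsum_bucketWeight (y : B) (hy : Q (κ ⁻¹' {κ y}) ≠ 0) : ∑' j, bucketWeight Q κ j y = 1 := by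
  unfold bucketWeight
  rw [tsum_unpair fun k m => if κ y = k ∧ m < bucketCount Q κ k then
    (bucketCount Q κ k : ℝ≥0∞)⁻¹ else 0, tsum_eq_single (κ y)]
  · simpa using sum_ite_lt_inv (bucketCount_ne_zero hy)
  · intro k hk
    simp [hk.symm]

lemma ae_bucket_ne_zero : ∀ᵐ y ∂Q, Q (κ ⁻¹' {κ y}) ≠ 0 := by
  have h : ∀ k, ∀ᵐ y ∂Q, Q (κ ⁻¹' {k}) = 0 → κ y ≠ k := fun k => by
    by_cases hk : Q (κ ⁻¹' {k}) = 0
    · have : ∀ᵐ y ∂Q, y ∉ κ ⁻¹' {k} := measure_eq_zero_iff_ae_notMem.1 hk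
      filter_upwards [this] with y hy _ h
      exact hy h
    · exact Eventually.of_forall fun y h => absurd h hk
  filter_upwards [ae_all_iff.2 h] with y hy h0
  exact hy _ h0 rfl

lemma lintegral_bucketWeight (hκ : Measurable κ) (j : ℕ) :
    ∫⁻ y, bucketWeight Q κ j y ∂Q = if j.unpair.2 < bucketCount Q κ j.unpair.1 then
      (bucketCount Q κ j.unpair.1 : ℝ≥0∞)⁻¹ * Q (κ ⁻¹' {j.unpair.1}) else 0 := by
  split_ifs with h
  · have : bucketWeight Q κ j = (κ ⁻¹' {j.unpair.1}).indicator
        fun _ => (bucketCount Q κ j.unpair.1 : ℝ≥0∞)⁻¹ := by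
      ext y
      by_cases hy : κ y = j.unpair.1 <;> simp [bucketWeight, h, hy]
    rw [this, lintegral_indicator (hκ (measurableSet_singleton _))]
    simp
  · simp [bucketWeight, h]

lemma setLIntegral_bucketLaw (hκ : Measurable κ) (d : B → ℝ≥0∞) (j : ℕ) {S : Set B}
    (hS : MeasurableSet S) :
    ∫⁻ y in S, bucketWeight Q κ j y * d y * Q (κ ⁻¹' {j.unpair.1}) ∂(bucketLaw Q κ j)
      = ∫⁻ y in S, bucketWeight Q κ j y * d y ∂Q := by
  by_cases h : Q (κ ⁻¹' {j.unpair.1}) = 0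
  · have h0 : ∀ y, bucketWeight Q κ j y = 0 := fun y => by
      simp [bucketWeight, bucketCount_eq_zero h]
    simp [h0]
  · have hL : MeasurableSet (κ ⁻¹' {j.unpair.1}) := hκ (measurableSet_singleton _)
    have hind : ∀ y, bucketWeight Q κ j y * d y
        = (κ ⁻¹' {j.unpair.1}).indicator (fun y => bucketWeight Q κ j y * d y) y := fun y => by
      by_cases hy : κ y = j.unpair.1
      · simp [hy]
      · simp [hy, bucketWeight]
    rw [lintegral_mul_const' _ _ (measure_ne_top _ _), bucketLaw, if_neg h, ProbabilityTheory.cond,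
      Measure.restrict_smul, lintegral_smul_measure, smul_eq_mul, mul_comm, ← mul_assoc,
      ENNReal.mul_inv_cancel h (measure_ne_top _ _), one_mul, Measure.restrict_restrict hS,
      Set.inter_comm, ← Measure.restrict_restrict hL, ← lintegral_indicator hL]
    exact lintegral_congr fun y => (hind y).symm

lemma bucketWeight_mul_le_one {d : B → ℝ≥0∞} {y : B} (hd : d y ≤ 2 ^ (κ y + 1)) (j : ℕ) :
    bucketWeight Q κ j y * d y * Q (κ ⁻¹' {j.unpair.1}) ≤ 1 := by
  unfold bucketWeight
  split_ifs with h
  · obtain ⟨h1, h2⟩ := h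
    rw [← h1] at h2 ⊢
    have hN : (bucketCount Q κ (κ y) : ℝ≥0∞) ≠ 0 := by simpa using (Nat.zero_lt_of_lt h2).ne'
    calc _ ≤ (bucketCount Q κ (κ y) : ℝ≥0∞)⁻¹ * (2 ^ (κ y + 1) * Q (κ ⁻¹' {κ y})) := by
          rw [mul_assoc]; gcongr
      _ ≤ (bucketCount Q κ (κ y) : ℝ≥0∞)⁻¹ * bucketCount Q κ (κ y) := by
          gcongr; exact le_bucketCount _
      _ = 1 := ENNReal.inv_mul_cancel hN (by simp)
  · simp

/-- The logarithm of a rounded-up count, weighted by its mass, exceeds the level by little. -/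
lemma logb_ceil_div_le {q : ℝ} (hq : 0 < q) (k : ℕ) :
    Real.logb 2 ((⌈2 ^ (k + 1) * q⌉₊ : ℝ) / q) ≤ k + 1 + 2⁻¹ ^ k / q := by
  have hpow : (0 : ℝ) < 2 ^ (k + 1) := by positivity
  have h1 : (⌈2 ^ (k + 1) * q⌉₊ : ℝ) / q ≤ 2 ^ (k + 1) * (1 + 2⁻¹ ^ (k + 1) / q) := by
    rw [div_le_iff₀ hq]
    have := (Nat.ceil_lt_add_one (a := (2 : ℝ) ^ (k + 1) * q) (by positivity)).le
    have h0 : (2 : ℝ) ^ (k + 1) * 2⁻¹ ^ (k + 1) = 1 := by rw [← mul_pow]; norm_num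
    calc _ ≤ _ := this
      _ = 2 ^ (k + 1) * q + 2 ^ (k + 1) * 2⁻¹ ^ (k + 1) * (q / q) := by
        rw [h0, div_self hq.ne', one_mul]
      _ = _ := by ring
  have h2 : 0 < (⌈2 ^ (k + 1) * q⌉₊ : ℝ) / q := by
    have : 0 < ⌈2 ^ (k + 1) * q⌉₊ := Nat.ceil_pos.2 (by positivity)
    positivity
  have hlog2 : (2 : ℝ)⁻¹ ≤ Real.log 2 := by have := Real.log_two_gt_d9; norm_num; linarith
  have h3 : Real.logb 2 (1 + 2⁻¹ ^ (k + 1) / q) ≤ 2⁻¹ ^ k / q := by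
    rw [Real.logb, div_le_iff₀ (by linarith)]
    have h4 := Real.log_le_sub_one_of_pos (x := 1 + 2⁻¹ ^ (k + 1) / q) (by positivity)
    have h5 : (0 : ℝ) ≤ 2⁻¹ ^ k / q := by positivity
    have h6 : (2 : ℝ)⁻¹ ^ (k + 1) / q = 2⁻¹ ^ k / q * 2⁻¹ := by ring
    nlinarith
  calc _ ≤ Real.logb 2 (2 ^ (k + 1) * (1 + 2⁻¹ ^ (k + 1) / q)) :=
        Real.logb_le_logb_of_le (by norm_num) h2 h1
    _ = k + 1 + Real.logb 2 (1 + 2⁻¹ ^ (k + 1) / q) := by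
        rw [Real.logb_mul hpow.ne' (by positivity), Real.logb_pow,
          Real.logb_self_eq_one (by norm_num)]
        push_cast; ring
    _ ≤ _ := by linarith

lemma tsum_inv_two_pow_succ : ∑' t : ℕ, (2 : ℝ≥0∞)⁻¹ ^ (t + 1) = 1 := by
  simp_rw [pow_succ]
  rw [ENNReal.tsum_mul_right, ENNReal.tsum_geometric, ENNReal.one_sub_inv_two, inv_inv]
  exact ENNReal.mul_inv_cancel (by simp) (by simp)

lemma tsum_inv_two_pow : ∑' t : ℕ, (2 : ℝ≥0∞)⁻¹ ^ t = 2 := by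
  rw [ENNReal.tsum_geometric, ENNReal.one_sub_inv_two, inv_inv]

lemma tsum_inv_two_pow_succ_mul : ∑' t : ℕ, (2 : ℝ≥0∞)⁻¹ ^ (t + 1) * t = 1 := by
  have h := (hasSum_coe_mul_geometric_of_norm_lt_one (r := (2 : ℝ)⁻¹) (by norm_num)).mul_right
    (2 : ℝ)⁻¹
  have h2 : (2 : ℝ)⁻¹ / (1 - 2⁻¹) ^ 2 * 2⁻¹ = 1 := by norm_num
  rw [h2] at h
  have h3 := ENNReal.ofReal_tsum_of_nonneg (fun t => by positivity) h.summable
  rw [h.tsum_eq, ENNReal.ofReal_one] at h3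
  rw [h3]
  refine tsum_congr fun t => ?_
  rw [ENNReal.ofReal_mul (by positivity), ENNReal.ofReal_mul (by positivity),
    ENNReal.ofReal_pow (by positivity), ENNReal.ofReal_inv_of_pos (by norm_num)]
  simp
  ring

lemma tsum_measure_fiber (hκ : Measurable κ) : ∑' k, Q (κ ⁻¹' {k}) = 1 := by
  have := measure_iUnion (μ := Q) (f := fun k => κ ⁻¹' {k}) (fun i j hij =>
    Disjoint.preimage _ (Set.disjoint_singleton.2 hij)) fun k => hκ (measurableSet_singleton k)
  rw [← this]
  have hU : ⋃ k, κ ⁻¹' {k} = Set.univ := by ext; simp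
  rw [hU, measure_univ]

/-- The expected codeword length of an ideal code for the pair of a geometric round number and
the index of a candidate. -/
lemma tsum_bucket_length_le (hκ : Measurable κ) {p : ℕ × ℕ → ℝ≥0∞}
    (hp : ∀ i, p i = 2⁻¹ ^ (i.1 + 1) * ∫⁻ y, bucketWeight Q κ i.2 y ∂Q) :
    ∑' i, p i * ENNReal.ofReal (2 - Real.logb 2 (p i).toReal)
      ≤ ∫⁻ y, (κ y : ℝ≥0∞) ∂Q + 7 := by
  have hterm : ∀ i : ℕ × ℕ, p i * ENNReal.ofReal (2 - Real.logb 2 (p i).toReal)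
      ≤ 2⁻¹ ^ (i.1 + 1) * ((if i.2.unpair.2 < bucketCount Q κ i.2.unpair.1 then
        (bucketCount Q κ i.2.unpair.1 : ℝ≥0∞)⁻¹ else 0) *
        (Q (κ ⁻¹' {i.2.unpair.1}) * (i.1 + i.2.unpair.1 + 4) + 2⁻¹ ^ i.2.unpair.1)) := by
    rintro ⟨t, j⟩
    have hpj := hp (t, j)
    rw [lintegral_bucketWeight hκ] at hpj
    simp only at hpj ⊢
    set k := j.unpair.1
    set N := bucketCount Q κ k with hN
    set q := Q (κ ⁻¹' {k}) with hq
    split_ifs at hpj ⊢ with hm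
    · rw [hpj, mul_assoc, mul_assoc]
      gcongr
      by_cases hq0 : q = 0
      · simp [hq0]
      have hqt : q ≠ ∞ := measure_ne_top _ _
      have hqr : 0 < q.toReal := ENNReal.toReal_pos hq0 hqt
      have hN0 : (N : ℝ) ≠ 0 := by exact_mod_cast (Nat.zero_lt_of_lt hm).ne'
      have hreal : (2⁻¹ ^ (t + 1) * ((N : ℝ≥0∞)⁻¹ * q)).toReal
          = (2 : ℝ)⁻¹ ^ (t + 1) * (N / q.toReal)⁻¹ := by
        simp [ENNReal.toReal_mul, ENNReal.toReal_inv]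
        field_simp
      have hlog : Real.logb 2 ((2 : ℝ)⁻¹ ^ (t + 1) * (N / q.toReal)⁻¹)
          = -(t + 1) - Real.logb 2 (N / q.toReal) := by
        rw [Real.logb_mul (by positivity) (by positivity), Real.logb_pow, Real.logb_inv,
          Real.logb_inv, Real.logb_self_eq_one (by norm_num)]
        push_cast; ring
      have hlen := logb_ceil_div_le hqr k
      calc q * ENNReal.ofReal (2 - Real.logb 2 (2⁻¹ ^ (t + 1) * ((N : ℝ≥0∞)⁻¹ * q)).toReal)
          ≤ q * ENNReal.ofReal (t + k + 4 + 2⁻¹ ^ k / q.toReal) := by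
            gcongr
            rw [hreal, hlog]
            simp only [hN, bucketCount, ← hq]
            linarith
        _ = q * (t + k + 4 + 2⁻¹ ^ k / q) := by
            rw [ENNReal.ofReal_add (by positivity) (by positivity),
              ENNReal.ofReal_add (by positivity) (by positivity),
              ENNReal.ofReal_add (by positivity) (by positivity),
              ENNReal.ofReal_div_of_pos hqr, ENNReal.ofReal_toReal hqt,
              ENNReal.ofReal_pow (by positivity), ENNReal.ofReal_inv_of_pos (by norm_num)]
            simp
        _ ≤ q * (t + k + 4) + 2⁻¹ ^ k := by
            rw [mul_add]
            gcongr
            exact ENNReal.mul_div_le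
    · simp [hpj]
  refine (ENNReal.tsum_le_tsum hterm).trans ?_
  rw [ENNReal.tsum_prod']
  have hinner : ∀ t : ℕ, ∑' j : ℕ, 2⁻¹ ^ (t + 1) *
      ((if j.unpair.2 < bucketCount Q κ j.unpair.1 then
        (bucketCount Q κ j.unpair.1 : ℝ≥0∞)⁻¹ else 0) *
        (Q (κ ⁻¹' {j.unpair.1}) * (t + j.unpair.1 + 4) + 2⁻¹ ^ j.unpair.1))
      ≤ 2⁻¹ ^ (t + 1) * t + 2⁻¹ ^ (t + 1) * (∫⁻ y, (κ y : ℝ≥0∞) ∂Q + 6) := by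
    intro t
    rw [ENNReal.tsum_mul_left, ← mul_add, tsum_unpair fun k m =>
      (if m < bucketCount Q κ k then (bucketCount Q κ k : ℝ≥0∞)⁻¹ else 0) *
        (Q (κ ⁻¹' {k}) * (t + k + 4) + 2⁻¹ ^ k)]
    gcongr
    calc _ ≤ ∑' k : ℕ, (Q (κ ⁻¹' {k}) * (t + k + 4) + 2⁻¹ ^ k) := by
          refine ENNReal.tsum_le_tsum fun k => ?_
          rw [ENNReal.tsum_mul_right]
          refine mul_le_of_le_one_left' ?_
          by_cases hN : bucketCount Q κ k = 0
          · simp [hN]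
          · exact (sum_ite_lt_inv hN).le
      _ = ∑' k : ℕ, (Q (κ ⁻¹' {k}) * (t + 4) + k * Q (κ ⁻¹' {k}) + 2⁻¹ ^ k) := by
          refine tsum_congr fun k => ?_
          ring
      _ = t + (∫⁻ y, (κ y : ℝ≥0∞) ∂Q + 6) := by
          rw [ENNReal.tsum_add, ENNReal.tsum_add, ENNReal.tsum_mul_right, tsum_measure_fiber hκ,
            tsum_inv_two_pow]
          have : ∫⁻ y, (κ y : ℝ≥0∞) ∂Q = ∑' k : ℕ, (k : ℝ≥0∞) * Q (κ ⁻¹' {k}) := by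
            rw [← lintegral_map (f := fun k : ℕ => (k : ℝ≥0∞)) (measurable_of_countable _) hκ,
              lintegral_countable']
            exact tsum_congr fun k => by rw [Measure.map_apply hκ (measurableSet_singleton k)]
          rw [this]
          ring
  refine (ENNReal.tsum_le_tsum hinner).trans (le_of_eq ?_)
  rw [ENNReal.tsum_add, tsum_inv_two_pow_succ_mul, ENNReal.tsum_mul_right, tsum_inv_two_pow_succ]
  ring

end Buckets

section Achievability

variable {A B : Type} [MeasurableSpace A] [MeasurableSpace B]

lemma ae_lintegral_density_eq_one {μ : Measure A} [IsProbabilityMeasure μ] {Q : Measure B}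
    [IsProbabilityMeasure Q] {d : A × B → ℝ≥0∞} (hd : Measurable d)
    (h : ((μ.prod Q).withDensity d).fst = μ) : ∀ᵐ x ∂μ, ∫⁻ y, d (x, y) ∂Q = 1 := by
  refine ae_eq_of_forall_setLIntegral_eq_of_sigmaFinite hd.lintegral_prod_right'
    measurable_const fun s hs _ => ?_
  have h1 : ((μ.prod Q).withDensity d).fst s = μ s := by rw [h]
  rw [Measure.fst_apply hs, withDensity_apply _ (measurable_fst hs),
    ← lintegral_indicator (measurable_fst hs),
    lintegral_prod _ (hd.indicator (measurable_fst hs)).aemeasurable] at h1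
  rw [lintegral_const, one_mul, Measure.restrict_apply_univ, ← h1, ← lintegral_indicator hs]
  refine lintegral_congr fun x => ?_
  by_cases hx : x ∈ s <;> simp [hx]

lemma natFloor_logb_le {r : ℝ} (hr : 0 < r) :
    (⌊Real.logb 2 r⌋₊ : ℝ) ≤ Real.logb 2 r + 2 * r⁻¹ := by
  have hr' : 0 < r⁻¹ := by positivity
  have hlog2 : (2 : ℝ)⁻¹ ≤ Real.log 2 := by have := Real.log_two_gt_d9; norm_num; linarith
  have h1 : -Real.logb 2 r ≤ 2 * r⁻¹ := by
    rw [← Real.logb_inv, Real.logb, div_le_iff₀ (by linarith)]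
    have := Real.log_le_sub_one_of_pos hr'
    nlinarith
  rcases le_total 0 (Real.logb 2 r) with h | h
  · linarith [Nat.floor_le h]
  · rw [Nat.floor_of_nonpos h]
    push_cast
    linarith

lemma ofReal_le_two_pow_natFloor_logb {r : ℝ} (hr : 0 < r) :
    ENNReal.ofReal r ≤ 2 ^ (⌊Real.logb 2 r⌋₊ + 1) := by
  have h := (Nat.lt_floor_add_one (Real.logb 2 r)).le
  rw [Real.logb_le_iff_le_rpow (by norm_num) hr] at h
  have h2 : r ≤ 2 ^ (⌊Real.logb 2 r⌋₊ + 1) := by exact_mod_cast h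
  refine (ENNReal.ofReal_le_ofReal h2).trans (le_of_eq ?_)
  rw [ENNReal.ofReal_pow (by norm_num)]
  simp

/-- One-shot achievability: a joint law whose density is a function of the output alone on its
support can be simulated at an expected length exceeding its information by a constant. -/
theorem exists_scheme (μ : Measure A) [IsProbabilityMeasure μ] (Q : Measure B)
    [IsProbabilityMeasure Q] {S : Set (A × B)} (hS : MeasurableSet S) {φ : B → ℝ}
    (hφ : Measurable φ) (hpos : ∀ y, 0 < φ y) {P : Measure (A × B)} [IsProbabilityMeasure P]
    (hP : P = (μ.prod Q).withDensity (S.indicator fun z => ENNReal.ofReal (φ z.2)))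
    (hfst : P.fst = μ) (hsnd : P.snd = Q)
    (hint : Integrable (fun z => Real.logb 2 (φ z.2)) P) :
    ∃ (𝒰 : Type) (_ : MeasurableSpace 𝒰) (μU : Measure 𝒰) (_ : IsProbabilityMeasure μU)
      (f : A → 𝒰 → List Bool) (g : List Bool → 𝒰 → B),
      Measurable (fun p : A × 𝒰 => f p.1 p.2) ∧
      Measurable (fun p : List Bool × 𝒰 => g p.1 p.2) ∧
      (∀ (u : 𝒰) (x₁ x₂ : A), (f x₁ u) <+: (f x₂ u) → f x₁ u = f x₂ u) ∧
      Measure.map (fun p : A × 𝒰 => (p.1, g (f p.1 p.2) p.2)) (μ.prod μU) = P ∧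
      Integrable (fun p : A × 𝒰 => ((f p.1 p.2).length : ℝ)) (μ.prod μU) ∧
      ∫ p, ((f p.1 p.2).length : ℝ) ∂(μ.prod μU) ≤ ∫ z, Real.logb 2 (φ z.2) ∂P + 9 := by
  have hD : Measurable (S.indicator fun z : A × B => ENNReal.ofReal (φ z.2)) :=
    ((hφ.comp measurable_snd).ennreal_ofReal).indicator hS
  set κ : B → ℕ := fun y => ⌊Real.logb 2 (φ y)⌋₊
  have hκ : Measurable κ := Nat.measurable_floor.comp ((Real.measurable_log.comp hφ).div_const _)
  set d : A → B → ℝ≥0∞ := fun x y => S.indicator (fun z => ENNReal.ofReal (φ z.2)) (x, y)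
  have hunc : Function.uncurry d = S.indicator fun z => ENNReal.ofReal (φ z.2) := rfl
  have hdle : ∀ x y, d x y ≤ 2 ^ (κ y + 1) := fun x y =>
    (Set.indicator_le_self' (fun _ _ => zero_le) _).trans
      (ofReal_le_two_pow_natFloor_logb (hpos y))
  have hsum : ∀ᵐ y ∂Q, ∑' j, bucketWeight Q κ j y = 1 := by
    filter_upwards [ae_bucket_ne_zero] with y hy using tsum_bucketWeight y hy
  obtain ⟨𝒰, _, μU, _, I, Y, hI, hY, hIY⟩ := exists_sampler μ Q (d := d) hD
    (ae_lintegral_density_eq_one hD (hP ▸ hfst)) (measurable_bucketWeight hκ) hsum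
    (bucketLaw Q κ)
    (α := fun j x y => bucketWeight Q κ j y * d x y * Q (κ ⁻¹' {j.unpair.1}))
    (fun j => (((measurable_bucketWeight hκ j).comp measurable_snd).mul hD).mul_const _)
    (fun j x y => bucketWeight_mul_le_one (hdle x y) j)
    (fun j x T hT => setLIntegral_bucketLaw hκ _ j hT)
  rw [hunc, ← hP] at hIY
  have hwm : ∀ j, Measurable fun z : A × B => bucketWeight Q κ j z.2 := fun j =>
    (measurable_bucketWeight hκ j).comp measurable_snd
  have hmp : MeasurePreserving Prod.snd P Q := ⟨measurable_snd, hsnd⟩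
  have hsumP : ∀ᵐ z ∂P, ∑' j, bucketWeight Q κ j z.2 = 1 := hmp.quasiMeasurePreserving.ae hsum
  let W : ℕ × ℕ → Measure (A × B) := fun i =>
    (2⁻¹ ^ (i.1 + 1) : ℝ≥0∞) • P.withDensity fun z => bucketWeight Q κ i.2 z.2
  have hWapp : ∀ i Z, MeasurableSet Z →
      W i Z = 2⁻¹ ^ (i.1 + 1) * ∫⁻ z in Z, bucketWeight Q κ i.2 z.2 ∂P := fun i Z hZ => by
    simp [W, withDensity_apply _ hZ]
  obtain ⟨f, g, hf, hg, hpre, hmap, hlen⟩ := exists_code_of_sampler (P := P) hI hY (W := W)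
    (fun i Z hZ => (hWapp i Z hZ).trans_le (hIY i Z hZ)) fun Z hZ => by
      simp_rw [hWapp _ Z hZ]
      rw [ENNReal.tsum_prod']
      simp_rw [ENNReal.tsum_mul_left]
      rw [ENNReal.tsum_mul_right, tsum_inv_two_pow_succ, one_mul,
        ← lintegral_tsum fun j => (hwm j).aemeasurable,
        lintegral_congr_ae (ae_restrict_of_ae hsumP)]
      simp
  refine ⟨𝒰, _, μU, inferInstance, f, g, hf, hg, hpre, hmap, ?_⟩
  have hWuniv : ∀ i, W i Set.univ = 2⁻¹ ^ (i.1 + 1) * ∫⁻ y, bucketWeight Q κ i.2 y ∂Q :=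
    fun i => by
      rw [hWapp i _ MeasurableSet.univ, Measure.restrict_univ,
        hmp.lintegral_comp (measurable_bucketWeight hκ i.2)]
  have hbound := hlen.trans (tsum_bucket_length_le hκ hWuniv)
  have hinvm : Measurable fun z : A × B => (φ z.2)⁻¹ := (hφ.comp measurable_snd).inv
  have hinv : ∫⁻ z, ENNReal.ofReal (φ z.2)⁻¹ ∂P ≤ 1 := by
    rw [hP, lintegral_withDensity_eq_lintegral_mul _ hD hinvm.ennreal_ofReal]
    calc _ ≤ ∫⁻ _, 1 ∂(μ.prod Q) := by
          refine lintegral_mono fun z => ?_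
          by_cases hz : z ∈ S
          · simp [hz, ← ENNReal.ofReal_mul (hpos _).le, mul_inv_cancel₀ (hpos z.2).ne']
          · simp [hz]
      _ = 1 := by simp
  have hinv0 : 0 ≤ᵐ[P] fun z => (φ z.2)⁻¹ :=
    Eventually.of_forall fun z => (inv_pos.2 (hpos z.2)).le
  have hinvi : Integrable (fun z : A × B => (φ z.2)⁻¹) P := by
    refine ⟨hinvm.aestronglyMeasurable, ?_⟩
    rw [hasFiniteIntegral_iff_ofReal hinv0]
    exact hinv.trans_lt ENNReal.one_lt_top
  have hinv1 : ∫ z, (φ z.2)⁻¹ ∂P ≤ 1 := by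
    rw [integral_eq_lintegral_of_nonneg_ae hinv0 hinvm.aestronglyMeasurable]
    exact ENNReal.toReal_le_of_le_ofReal zero_le_one (by simpa using hinv)
  have hnonneg : ∀ z : A × B, 0 ≤ Real.logb 2 (φ z.2) + 2 * (φ z.2)⁻¹ := fun z =>
    (Nat.cast_nonneg _).trans (natFloor_logb_le (hpos z.2))
  have hκint : ∫⁻ y, (κ y : ℝ≥0∞) ∂Q ≤ ENNReal.ofReal (∫ z, Real.logb 2 (φ z.2) ∂P + 2) := by
    rw [← hmp.lintegral_comp (by fun_prop)]
    calc _ ≤ ∫⁻ z, ENNReal.ofReal (Real.logb 2 (φ z.2) + 2 * (φ z.2)⁻¹) ∂P := by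
          refine lintegral_mono fun z => ?_
          rw [← ENNReal.ofReal_natCast]
          exact ENNReal.ofReal_le_ofReal (natFloor_logb_le (hpos z.2))
      _ = ENNReal.ofReal (∫ z, (Real.logb 2 (φ z.2) + 2 * (φ z.2)⁻¹) ∂P) :=
          (ofReal_integral_eq_lintegral_ofReal (hint.add (hinvi.const_mul 2))
            (Eventually.of_forall hnonneg)).symm
      _ ≤ _ := by
          rw [integral_add hint (hinvi.const_mul 2), integral_const_mul]
          exact ENNReal.ofReal_le_ofReal (by linarith)
  have h0 : 0 ≤ ∫ z, Real.logb 2 (φ z.2) ∂P + 2 := by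
    have : 0 ≤ ∫ z, (Real.logb 2 (φ z.2) + 2 * (φ z.2)⁻¹) ∂P := integral_nonneg hnonneg
    rw [integral_add hint (hinvi.const_mul 2), integral_const_mul] at this
    linarith
  have htot : ∫⁻ p, ENNReal.ofReal ((f p.1 p.2).length : ℝ) ∂(μ.prod μU)
      ≤ ENNReal.ofReal (∫ z, Real.logb 2 (φ z.2) ∂P + 9) := by
    simp_rw [ENNReal.ofReal_natCast]
    refine hbound.trans ((add_le_add_left hκint 7).trans (le_of_eq ?_))
    have h7 : (7 : ℝ≥0∞) = ENNReal.ofReal 7 := by simp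
    rw [h7, ← ENNReal.ofReal_add h0 (by norm_num)]
    congr 1
    ring
  have hlm : AEStronglyMeasurable (fun p : A × 𝒰 => ((f p.1 p.2).length : ℝ)) (μ.prod μU) :=
    ((measurable_of_countable fun s : List Bool => (s.length : ℝ)).comp hf).aestronglyMeasurable
  have hl0 : 0 ≤ᵐ[μ.prod μU] fun p : A × 𝒰 => ((f p.1 p.2).length : ℝ) :=
    Eventually.of_forall fun p => Nat.cast_nonneg _
  refine ⟨⟨hlm, ?_⟩, ?_⟩
  · rw [hasFiniteIntegral_iff_ofReal hl0]
    exact htot.trans_lt ENNReal.ofReal_lt_top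
  · rw [integral_eq_lintegral_of_nonneg_ae hl0 hlm]
    exact ENNReal.toReal_le_of_le_ofReal (by linarith) htot

end Achievability

section Converse

variable {A B : Type} [MeasurableSpace A] [MeasurableSpace B]

/-- One-shot converse: the expected length of any scheme is at least the expected logarithm of any
function whose average over the source is at most one for every output. -/
theorem integral_logb_le_length {𝒰 : Type} [MeasurableSpace 𝒰] {μ : Measure A}
    [IsProbabilityMeasure μ] {μU : Measure 𝒰} [IsProbabilityMeasure μU]
    {P : Measure (A × B)} {f : A → 𝒰 → List Bool} {g : List Bool → 𝒰 → B}
    (hf : Measurable fun p : A × 𝒰 => f p.1 p.2)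
    (hg : Measurable fun p : List Bool × 𝒰 => g p.1 p.2)
    (hpre : ∀ (u : 𝒰) (x₁ x₂ : A), (f x₁ u) <+: (f x₂ u) → f x₁ u = f x₂ u)
    (hmap : Measure.map (fun p : A × 𝒰 => (p.1, g (f p.1 p.2) p.2)) (μ.prod μU) = P)
    (hlen : Integrable (fun p : A × 𝒰 => ((f p.1 p.2).length : ℝ)) (μ.prod μU))
    {r : A × B → ℝ≥0∞} (hr : Measurable r) (hr1 : ∀ y, ∫⁻ x, r (x, y) ∂μ ≤ 1)
    (hrpos : ∀ᵐ z ∂P, r z ≠ 0 ∧ r z ≠ ∞)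
    (hint : Integrable (fun z => Real.logb 2 (r z).toReal) P) :
    ∫ z, Real.logb 2 (r z).toReal ∂P ≤ ∫ p, ((f p.1 p.2).length : ℝ) ∂(μ.prod μU) := by
  have hT : Measurable fun p : A × 𝒰 => (p.1, g (f p.1 p.2) p.2) :=
    measurable_fst.prodMk (hg.comp (hf.prodMk measurable_snd))
  have hmp : MeasurePreserving (fun p : A × 𝒰 => (p.1, g (f p.1 p.2) p.2)) (μ.prod μU) P :=
    ⟨hT, hmap⟩
  have hleng : Measurable fun s : List Bool => (2 : ℝ≥0∞)⁻¹ ^ s.length := measurable_of_countable _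
  set t : A × 𝒰 → ℝ≥0∞ := fun p => r (p.1, g (f p.1 p.2) p.2) * 2⁻¹ ^ (f p.1 p.2).length with ht
  have htm : Measurable t := (hr.comp hT).mul (hleng.comp hf)
  have ht1 : ∫⁻ p, t p ∂(μ.prod μU) ≤ 1 := by
    rw [lintegral_prod_symm' _ htm]
    calc _ ≤ ∫⁻ _, 1 ∂μU := by
          refine lintegral_mono fun u => ?_
          set R : Set (List Bool) := Set.range fun x => f x u
          calc ∫⁻ x, t (x, u) ∂μ
              ≤ ∫⁻ x, ∑' s, R.indicator (fun s => r (x, g s u) * 2⁻¹ ^ s.length) s ∂μ := by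
                refine lintegral_mono fun x => ?_
                refine le_trans ?_ (ENNReal.le_tsum (f x u))
                simp [R, ht]
            _ = ∑' s, ∫⁻ x, R.indicator (fun s => r (x, g s u) * 2⁻¹ ^ s.length) s ∂μ := by
                refine lintegral_tsum fun s => Measurable.aemeasurable ?_
                by_cases hs : s ∈ R
                · simp only [hs, Set.indicator_of_mem]
                  exact (hr.comp measurable_prodMk_right).mul_const _
                · simp [hs]
            _ ≤ ∑' s, R.indicator (fun s => 2⁻¹ ^ s.length) s := by
                refine ENNReal.tsum_le_tsum fun s => ?_
                by_cases hs : s ∈ R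
                · simp only [hs, Set.indicator_of_mem]
                  rw [lintegral_mul_const' _ _ (by simp)]
                  exact mul_le_of_le_one_left' (hr1 _)
                · simp [hs]
            _ ≤ 1 := by
                refine tsum_indicator_inv_two_pow_length_le_one ?_
                rintro _ ⟨x₁, rfl⟩ _ ⟨x₂, rfl⟩ h
                exact hpre u x₁ x₂ h
      _ = 1 := by simp
  have hti : Integrable (fun p => (t p).toReal) (μ.prod μU) :=
    integrable_toReal_of_lintegral_ne_top htm.aemeasurable (ht1.trans_lt ENNReal.one_lt_top).ne
  have hti1 : ∫ p, (t p).toReal ∂(μ.prod μU) ≤ 1 := by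
    rw [integral_toReal htm.aemeasurable
      (ae_lt_top htm (ht1.trans_lt ENNReal.one_lt_top).ne)]
    exact ENNReal.toReal_le_of_le_ofReal zero_le_one (by simpa using ht1)
  have hl2 : 0 < Real.log 2 := Real.log_pos (by norm_num)
  have hint' : Integrable (fun p : A × 𝒰 => Real.logb 2 (r (p.1, g (f p.1 p.2) p.2)).toReal)
      (μ.prod μU) := (hmp.integrable_comp hint.aestronglyMeasurable).2 hint
  have heq : ∫ z, Real.logb 2 (r z).toReal ∂P
      = ∫ p, Real.logb 2 (r (p.1, g (f p.1 p.2) p.2)).toReal ∂(μ.prod μU) := by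
    rw [← hmap, integral_map hT.aemeasurable (hmap ▸ hint.aestronglyMeasurable)]
  have hle : ∀ᵐ p ∂(μ.prod μU), Real.logb 2 (r (p.1, g (f p.1 p.2) p.2)).toReal
      - ((f p.1 p.2).length : ℝ) ≤ ((t p).toReal - 1) / Real.log 2 := by
    filter_upwards [hmp.quasiMeasurePreserving.ae hrpos] with p hp
    have hr0 : 0 < (r (p.1, g (f p.1 p.2) p.2)).toReal := ENNReal.toReal_pos hp.1 hp.2
    have htp : (t p).toReal
        = (r (p.1, g (f p.1 p.2) p.2)).toReal * 2⁻¹ ^ (f p.1 p.2).length := by simp [ht]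
    have htpos : 0 < (t p).toReal := by rw [htp]; positivity
    have hlog : Real.logb 2 (t p).toReal
        = Real.logb 2 (r (p.1, g (f p.1 p.2) p.2)).toReal - ((f p.1 p.2).length : ℝ) := by
      rw [htp, Real.logb_mul hr0.ne' (by positivity), Real.logb_pow, Real.logb_inv,
        Real.logb_self_eq_one (by norm_num)]
      ring
    rw [← hlog, Real.logb]
    exact div_le_div_of_nonneg_right (Real.log_le_sub_one_of_pos htpos) hl2.le
  have hfin := integral_mono_ae (hint'.sub hlen) ((hti.sub (integrable_const 1)).div_const _) hle
  simp only [Pi.sub_apply] at hfin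
  rw [integral_sub hint' hlen, integral_div, integral_sub hti (integrable_const 1)] at hfin
  have : (∫ p, (t p).toReal ∂(μ.prod μU) - ∫ _, (1 : ℝ) ∂(μ.prod μU)) / Real.log 2 ≤ 0 :=
    div_nonpos_of_nonpos_of_nonneg (by simpa using hti1) hl2.le
  linarith

end Converse

section SingleLetter

instance isProbabilityMeasure_pXY (pX : Measure 𝒳) [IsProbabilityMeasure pX] (κ : Kernel 𝒳 𝒴)
    [IsMarkovKernel κ] : IsProbabilityMeasure (pXY pX κ) := by
  unfold pXY; infer_instance

instance isProbabilityMeasure_pYout (pX : Measure 𝒳) [IsProbabilityMeasure pX] (κ : Kernel 𝒳 𝒴)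
    [IsMarkovKernel κ] : IsProbabilityMeasure (pYout pX κ) := by
  unfold pYout; infer_instance

lemma ae_lintegral_density_left_eq_one {A B : Type} [MeasurableSpace A] [MeasurableSpace B]
    {μ : Measure A} [IsProbabilityMeasure μ] {Q : Measure B} [IsProbabilityMeasure Q]
    {d : A × B → ℝ≥0∞} (hd : Measurable d)
    (h : ((μ.prod Q).withDensity d).snd = Q) : ∀ᵐ y ∂Q, ∫⁻ x, d (x, y) ∂μ = 1 := by
  refine ae_eq_of_forall_setLIntegral_eq_of_sigmaFinite hd.lintegral_prod_left'
    measurable_const fun s hs _ => ?_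
  have h1 : ((μ.prod Q).withDensity d).snd s = Q s := by rw [h]
  rw [Measure.snd_apply hs, withDensity_apply _ (measurable_snd hs),
    ← lintegral_indicator (measurable_snd hs),
    lintegral_prod_symm' _ (hd.indicator (measurable_snd hs))] at h1
  rw [lintegral_const, one_mul, Measure.restrict_apply_univ, ← h1, ← lintegral_indicator hs]
  refine lintegral_congr fun y => ?_
  by_cases hy : y ∈ s <;> simp [hy]

variable {pX : Measure 𝒳} [IsProbabilityMeasure pX] {κ : Kernel 𝒳 𝒴} [IsMarkovKernel κ]

lemma measurable_uncurry_rnDeriv : Measurable fun z : 𝒳 × 𝒴 =>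
    Kernel.rnDeriv κ (Kernel.const 𝒳 (pYout pX κ)) z.1 z.2 :=
  Kernel.measurable_rnDeriv _ _

lemma pXY_eq_withDensity (hac : pXY pX κ ≪ pX.prod (pYout pX κ)) :
    pXY pX κ = (pX.prod (pYout pX κ)).withDensity
      fun z => Kernel.rnDeriv κ (Kernel.const 𝒳 (pYout pX κ)) z.1 z.2 := by
  have hker : ∀ᵐ x ∂pX, κ x ≪ Kernel.const 𝒳 (pYout pX κ) x := by
    rw [← Measure.compProd_const] at hac
    exact hac.kernel_of_compProd
  rw [← Measure.compProd_const, ← Measure.compProd_withDensity (Kernel.measurable_rnDeriv _ _)]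
  refine Measure.compProd_congr ?_
  filter_upwards [hker] with x hx using (Kernel.withDensity_rnDeriv_eq hx).symm

/-- For a singular joint law, the density with respect to the product of the marginals can be taken
to be a positive function of the output on a measurable set and zero elsewhere. -/
lemma exists_density_of_singular (hac : pXY pX κ ≪ pX.prod (pYout pX κ))
    (hIfin : Integrable
      (fun z => Real.logb 2 ((pXY pX κ).rnDeriv (pX.prod (pYout pX κ)) z).toReal) (pXY pX κ))
    (hsing : Singular pX κ) :
    ∃ (S : Set (𝒳 × 𝒴)) (φ : 𝒴 → ℝ), MeasurableSet S ∧ Measurable φ ∧ (∀ y, 0 < φ y) ∧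
      pXY pX κ = (pX.prod (pYout pX κ)).withDensity
        (S.indicator fun z => ENNReal.ofReal (φ z.2)) ∧
      (∀ y, ∫⁻ x, S.indicator (fun z => ENNReal.ofReal (φ z.2)) (x, y) ∂pX ≤ 1) ∧
      Integrable (fun z => Real.logb 2 (φ z.2)) (pXY pX κ) ∧
      ∫ z, Real.logb 2 (φ z.2) ∂(pXY pX κ) = mutInfoBits pX κ := by
  set P := pXY pX κ with hPdef
  set Q := pYout pX κ with hQdef
  set R : 𝒳 × 𝒴 → ℝ≥0∞ := fun z => Kernel.rnDeriv κ (Kernel.const 𝒳 Q) z.1 z.2 with hRdef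
  have hR : Measurable R := measurable_uncurry_rnDeriv
  have hPR : P = (pX.prod Q).withDensity R := pXY_eq_withDensity hac
  have hder : P.rnDeriv (pX.prod Q) =ᵐ[P] R := by
    refine hac.ae_le ?_
    rw [hPR]
    exact Measure.rnDeriv_withDensity _ hR
  obtain ⟨h, hh, hcond⟩ := (stronglyMeasurable_condExp (μ := P) (f := _root_.llr pX κ)
    (m := MeasurableSpace.comap Prod.snd inferInstance)).measurable.exists_eq_measurable_comp
  have hllr : ∀ᵐ z ∂P, Real.logb 2 (R z).toReal = h z.2 := by
    have : _root_.llr pX κ =ᵐ[P] h ∘ Prod.snd := by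
      rw [← hcond]
      exact hsing
    exact this
  set φ : 𝒴 → ℝ := fun y => 2 ^ h y with hφdef
  have hφ : Measurable φ := Measurable.pow measurable_const hh
  have hφpos : ∀ y, 0 < φ y := fun y => by positivity
  have hRφ : ∀ᵐ z ∂P, R z = ENNReal.ofReal (φ z.2) := by
    filter_upwards [hllr, hder, Measure.rnDeriv_pos hac, hac.ae_le (Measure.rnDeriv_lt_top P _)]
      with z h1 h2 h3 h4
    rw [h2] at h3 h4
    have h5 : 0 < (R z).toReal := ENNReal.toReal_pos h3.ne' h4.ne
    have h6 : φ z.2 = 2 ^ Real.logb 2 (R z).toReal := by rw [h1]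
    rw [h6, Real.rpow_logb (by norm_num) (by norm_num) h5, ENNReal.ofReal_toReal h4.ne]
  have hG : MeasurableSet {y | ∫⁻ x, R (x, y) ∂pX ≤ 1} :=
    measurableSet_le hR.lintegral_prod_left' measurable_const
  have hmp : MeasurePreserving Prod.snd P Q := ⟨measurable_snd, rfl⟩
  have hGP : ∀ᵐ z ∂P, ∫⁻ x, R (x, z.2) ∂pX ≤ 1 := by
    refine hmp.quasiMeasurePreserving.ae (p := fun y => ∫⁻ x, R (x, y) ∂pX ≤ 1) ?_
    filter_upwards [ae_lintegral_density_left_eq_one hR (by rw [← hPR]; rfl)] with y hy using hy.le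
  set S : Set (𝒳 × 𝒴) := {z | R z = ENNReal.ofReal (φ z.2)} ∩
    Prod.snd ⁻¹' {y | ∫⁻ x, R (x, y) ∂pX ≤ 1} with hSdef
  have hS : MeasurableSet S :=
    (measurableSet_eq_fun hR (hφ.comp measurable_snd).ennreal_ofReal).inter (measurable_snd hG)
  have hind : S.indicator (fun z => ENNReal.ofReal (φ z.2)) = S.indicator R :=
    Set.indicator_congr fun z hz => hz.1.symm
  have hlog : (fun z => Real.logb 2 (P.rnDeriv (pX.prod Q) z).toReal)
      =ᵐ[P] fun z => Real.logb 2 (φ z.2) := by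
    filter_upwards [hder, hRφ] with z h1 h2
    rw [h1, h2, ENNReal.toReal_ofReal (hφpos _).le]
  refine ⟨S, φ, hS, hφ, hφpos, ?_, fun y => ?_, hIfin.congr hlog, ?_⟩
  · have hmem : ∀ᵐ z ∂P, z ∈ S := by
      filter_upwards [hRφ, hGP] with z h1 h2 using ⟨h1, h2⟩
    rw [hind, withDensity_indicator hS, ← restrict_withDensity hS, ← hPR,
      Measure.restrict_eq_self_of_ae_mem hmem]
  · rw [hind]
    by_cases hy : ∫⁻ x, R (x, y) ∂pX ≤ 1
    · exact (lintegral_mono fun x => Set.indicator_le_self' (fun _ _ => zero_le) _).trans hy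
    · have : ∀ x, (x, y) ∉ S := fun x hx => hy hx.2
      simp [this]
  · exact (integral_congr_ae hlog).symm

end SingleLetter

section MultiLetter

variable {ι : Type} [Fintype ι]

lemma lintegral_pi_prod {E : ι → Type} [∀ i, MeasurableSpace (E i)] (μ : ∀ i, Measure (E i))
    [∀ i, IsProbabilityMeasure (μ i)] {F : ∀ i, E i → ℝ≥0∞} (hF : ∀ i, Measurable (F i)) :
    ∫⁻ v, ∏ i, F i (v i) ∂(Measure.pi μ) = ∏ i, ∫⁻ x, F i x ∂(μ i) := by
  have hind : iIndepFun (fun i (v : ∀ i, E i) => F i (v i)) (Measure.pi μ) :=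
    iIndepFun_pi fun i => (hF i).aemeasurable
  rw [lintegral_prod_eq_prod_lintegral_of_indepFun Finset.univ _ hind
    fun i => (hF i).comp (measurable_pi_apply i)]
  exact Finset.prod_congr rfl fun i _ => (measurePreserving_eval μ i).lintegral_comp (hF i)

lemma pi_withDensity {E : Type} [MeasurableSpace E] (ρ : Measure E) [IsProbabilityMeasure ρ]
    {D : E → ℝ≥0∞} (hD : Measurable D) [IsProbabilityMeasure (ρ.withDensity D)] :
    Measure.pi (fun _ : ι => ρ.withDensity D) =
      (Measure.pi fun _ : ι => ρ).withDensity fun v => ∏ i, D (v i) := by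
  refine Measure.pi_eq fun s hs => ?_
  have hind : (Set.univ.pi s).indicator (fun v => ∏ i, D (v i)) =
      fun v : ι → E => ∏ i, (s i).indicator D (v i) := by
    funext v
    by_cases hv : ∀ i, v i ∈ s i
    · rw [Set.indicator_of_mem (by simpa using hv)]
      exact Finset.prod_congr rfl fun i _ => (Set.indicator_of_mem (hv i) _).symm
    · rw [Set.indicator_of_notMem (by simpa using hv)]
      push Not at hv
      obtain ⟨i, hi⟩ := hv
      exact (Finset.prod_eq_zero (Finset.mem_univ i) (Set.indicator_of_notMem hi _)).symm
  have hms : MeasurableSet (Set.univ.pi s) := MeasurableSet.univ_pi hs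
  rw [withDensity_apply _ hms, ← lintegral_indicator hms, hind,
    lintegral_pi_prod _ fun i => hD.indicator (hs i)]
  refine Finset.prod_congr rfl fun i _ => ?_
  rw [lintegral_indicator (hs i), withDensity_apply _ (hs i)]

lemma map_withDensity_comp {A B : Type} [MeasurableSpace A] [MeasurableSpace B] {μ : Measure A}
    {ν : Measure B} {e : A → B} (he : MeasurePreserving e μ ν) {F : B → ℝ≥0∞}
    (hF : Measurable F) : (μ.withDensity (F ∘ e)).map e = ν.withDensity F := by
  ext s hs
  rw [Measure.map_apply he.measurable hs, withDensity_apply _ hs,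
    withDensity_apply _ (he.measurable hs), ← he.map_eq, setLIntegral_map hs hF he.measurable]
  rfl

lemma measurable_unzip (n : ℕ) : Measurable fun v : Fin n → 𝒳 × 𝒴 =>
    ((fun i => (v i).1, fun i => (v i).2) : (Fin n → 𝒳) × (Fin n → 𝒴)) := by
  fun_prop

variable (pX : Measure 𝒳) [IsProbabilityMeasure pX] (κ : Kernel 𝒳 𝒴) [IsMarkovKernel κ] (n : ℕ)

instance isProbabilityMeasure_targetJoint : IsProbabilityMeasure (targetJoint pX κ n) :=
  Measure.isProbabilityMeasure_map (measurable_unzip n).aemeasurable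

lemma fst_targetJoint : (targetJoint pX κ n).fst = Measure.pi fun _ => pX := by
  have h1 : (pXY pX κ).map Prod.fst = pX := Measure.fst_compProd pX κ
  have : ∀ _ : Fin n, SigmaFinite ((pXY pX κ).map Prod.fst) := fun _ => by rw [h1]; infer_instance
  rw [Measure.fst, targetJoint, Measure.map_map measurable_fst (measurable_unzip n)]
  have h := Measure.pi_map_pi (μ := fun _ : Fin n => pXY pX κ) (f := fun _ => Prod.fst)
    fun _ => measurable_fst.aemeasurable
  rw [h1] at h
  exact h

lemma snd_targetJoint : (targetJoint pX κ n).snd = Measure.pi fun _ => pYout pX κ := by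
  have h1 : (pXY pX κ).map Prod.snd = pYout pX κ := rfl
  have : ∀ _ : Fin n, SigmaFinite ((pXY pX κ).map Prod.snd) := fun _ => by rw [h1]; infer_instance
  rw [Measure.snd, targetJoint, Measure.map_map measurable_snd (measurable_unzip n)]
  have h := Measure.pi_map_pi (μ := fun _ : Fin n => pXY pX κ) (f := fun _ => Prod.snd)
    fun _ => measurable_snd.aemeasurable
  rw [h1] at h
  exact h

lemma measurePreserving_letter (i : Fin n) :
    MeasurePreserving (fun z : (Fin n → 𝒳) × (Fin n → 𝒴) => (z.1 i, z.2 i))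
      (targetJoint pX κ n) (pXY pX κ) := by
  have hm : Measurable fun z : (Fin n → 𝒳) × (Fin n → 𝒴) => (z.1 i, z.2 i) := by fun_prop
  refine ⟨hm, ?_⟩
  rw [targetJoint, Measure.map_map hm (measurable_unzip n)]
  exact (measurePreserving_eval (fun _ : Fin n => pXY pX κ) i).map_eq

variable {pX κ}

lemma targetJoint_eq_withDensity {D : 𝒳 × 𝒴 → ℝ≥0∞} (hD : Measurable D)
    (h : pXY pX κ = (pX.prod (pYout pX κ)).withDensity D) :
    targetJoint pX κ n = ((Measure.pi fun _ : Fin n => pX).prod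
      (Measure.pi fun _ => pYout pX κ)).withDensity fun z => ∏ i, D (z.1 i, z.2 i) := by
  have : IsProbabilityMeasure ((pX.prod (pYout pX κ)).withDensity D) := by
    rw [← h]; infer_instance
  have hF : Measurable fun z : (Fin n → 𝒳) × (Fin n → 𝒴) => ∏ i, D (z.1 i, z.2 i) := by
    fun_prop
  rw [← map_withDensity_comp (measurePreserving_arrowProdEquivProdArrow 𝒳 𝒴 (Fin n)
    (fun _ => pX) (fun _ => pYout pX κ)) hF, targetJoint, h, pi_withDensity _ hD]
  rfl

variable {S : Set (𝒳 × 𝒴)} {φ : 𝒴 → ℝ}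

lemma prod_indicator_ofReal (hpos : ∀ y, 0 < φ y) (z : (Fin n → 𝒳) × (Fin n → 𝒴)) :
    ∏ i, S.indicator (fun w => ENNReal.ofReal (φ w.2)) (z.1 i, z.2 i) =
      {z : (Fin n → 𝒳) × (Fin n → 𝒴) | ∀ i, (z.1 i, z.2 i) ∈ S}.indicator
        (fun z => ENNReal.ofReal (∏ i, φ (z.2 i))) z := by
  by_cases hz : ∀ i, (z.1 i, z.2 i) ∈ S
  · rw [Set.indicator_of_mem (by exact hz), ENNReal.ofReal_prod_of_nonneg fun i _ => (hpos _).le]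
    exact Finset.prod_congr rfl fun i _ => by rw [Set.indicator_of_mem (hz i)]
  · rw [Set.indicator_of_notMem (by exact hz)]
    push Not at hz
    obtain ⟨i, hi⟩ := hz
    exact Finset.prod_eq_zero (Finset.mem_univ i) (Set.indicator_of_notMem hi _)

lemma logb_prod_letters (hpos : ∀ y, 0 < φ y) : (fun z : (Fin n → 𝒳) × (Fin n → 𝒴) =>
    Real.logb 2 (∏ i, φ (z.2 i))) = fun z => ∑ i, Real.logb 2 (φ (z.2 i)) := by
  funext z
  exact Real.logb_prod _ _ fun i _ => (hpos _).ne'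

lemma integrable_logb_prod (hpos : ∀ y, 0 < φ y)
    (hint : Integrable (fun z => Real.logb 2 (φ z.2)) (pXY pX κ)) :
    Integrable (fun z => Real.logb 2 (∏ i, φ (z.2 i))) (targetJoint pX κ n) := by
  rw [logb_prod_letters n hpos]
  exact integrable_finsetSum _ fun i _ =>
    (measurePreserving_letter pX κ n i).integrable_comp_of_integrable hint

lemma integral_logb_prod (hpos : ∀ y, 0 < φ y)
    (hint : Integrable (fun z => Real.logb 2 (φ z.2)) (pXY pX κ)) :
    ∫ z, Real.logb 2 (∏ i, φ (z.2 i)) ∂(targetJoint pX κ n) =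
      n * ∫ z, Real.logb 2 (φ z.2) ∂(pXY pX κ) := by
  have h : ∀ i : Fin n, ∫ z, Real.logb 2 (φ (z.2 i)) ∂(targetJoint pX κ n) =
      ∫ z, Real.logb 2 (φ z.2) ∂(pXY pX κ) := fun i => by
    have hmp := measurePreserving_letter pX κ n i
    rw [← hmp.map_eq, integral_map hmp.measurable.aemeasurable]
    rw [hmp.map_eq]
    exact hint.aestronglyMeasurable
  have hi : ∀ i : Fin n, Integrable (fun z => Real.logb 2 (φ (z.2 i))) (targetJoint pX κ n) :=
    fun i => (measurePreserving_letter pX κ n i).integrable_comp_of_integrable hint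
  rw [logb_prod_letters n hpos, integral_finsetSum _ fun i _ => hi i,
    Finset.sum_congr rfl fun i _ => h i]
  simp

variable (pX κ) in
/-- The average rates of the `n`-letter schemes that simulate the channel. -/
def achievableRates : Set ℝ :=
  {r : ℝ |
    ∃ (𝒰 : Type) (_ : MeasurableSpace 𝒰) (μU : Measure 𝒰) (_ : IsProbabilityMeasure μU)
      (f : (Fin n → 𝒳) → 𝒰 → List Bool) (g : List Bool → 𝒰 → (Fin n → 𝒴)),
      Measurable (fun p : (Fin n → 𝒳) × 𝒰 => f p.1 p.2) ∧
      Measurable (fun p : List Bool × 𝒰 => g p.1 p.2) ∧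
      (∀ (u : 𝒰) (x₁ x₂ : Fin n → 𝒳), (f x₁ u) <+: (f x₂ u) → f x₁ u = f x₂ u) ∧
      Measure.map (fun p : (Fin n → 𝒳) × 𝒰 => (p.1, g (f p.1 p.2) p.2))
          ((Measure.pi fun _ : Fin n => pX).prod μU) = targetJoint pX κ n ∧
      Integrable (fun p : (Fin n → 𝒳) × 𝒰 => ((f p.1 p.2).length : ℝ))
          ((Measure.pi fun _ : Fin n => pX).prod μU) ∧
      r = (1 / n : ℝ) * ∫ p, ((f p.1 p.2).length : ℝ)
            ∂((Measure.pi fun _ : Fin n => pX).prod μU)}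

variable (pX κ) in
lemma Rn_eq_sInf_achievableRates : Rn pX κ n = sInf (achievableRates pX κ n) := rfl

/-- The rate of exact synthesis of a channel whose density is a function of the output exceeds the
mutual information by at most a constant number of bits per block. -/
lemma Rn_mem_Icc (hS : MeasurableSet S) (hφ : Measurable φ) (hpos : ∀ y, 0 < φ y)
    (h : pXY pX κ = (pX.prod (pYout pX κ)).withDensity
      (S.indicator fun z => ENNReal.ofReal (φ z.2)))
    (hle : ∀ y, ∫⁻ x, S.indicator (fun z => ENNReal.ofReal (φ z.2)) (x, y) ∂pX ≤ 1)
    (hint : Integrable (fun z => Real.logb 2 (φ z.2)) (pXY pX κ)) (hn : 0 < n) :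
    Rn pX κ n ∈ Set.Icc (∫ z, Real.logb 2 (φ z.2) ∂(pXY pX κ))
      (∫ z, Real.logb 2 (φ z.2) ∂(pXY pX κ) + 9 / n) := by
  have hn' : (0 : ℝ) < n := by exact_mod_cast hn
  set T : Set ((Fin n → 𝒳) × (Fin n → 𝒴)) := {z | ∀ i, (z.1 i, z.2 i) ∈ S} with hTdef
  have hT : MeasurableSet T := by
    rw [hTdef, Set.ofPred_forall]
    exact MeasurableSet.iInter fun i => by
      have hm : Measurable fun z : (Fin n → 𝒳) × (Fin n → 𝒴) => (z.1 i, z.2 i) := by fun_prop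
      exact hm hS
  have hφn : Measurable fun y : Fin n → 𝒴 => ∏ i, φ (y i) := by fun_prop
  have hposn : ∀ y : Fin n → 𝒴, 0 < ∏ i, φ (y i) := fun y => Finset.prod_pos fun i _ => hpos _
  have hD : Measurable (S.indicator fun z => ENNReal.ofReal (φ z.2)) :=
    (hφ.comp measurable_snd).ennreal_ofReal.indicator hS
  set r : (Fin n → 𝒳) × (Fin n → 𝒴) → ℝ≥0∞ :=
    T.indicator fun z => ENNReal.ofReal (∏ i, φ (z.2 i)) with hrdef
  have hr : Measurable r := (hφn.comp measurable_snd).ennreal_ofReal.indicator hT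
  have hrprod : (fun z : (Fin n → 𝒳) × (Fin n → 𝒴) =>
      ∏ i, S.indicator (fun w => ENNReal.ofReal (φ w.2)) (z.1 i, z.2 i)) = r :=
    funext fun z => prod_indicator_ofReal n hpos z
  have hP := targetJoint_eq_withDensity n hD h
  rw [hrprod] at hP
  have hintn := integrable_logb_prod n hpos hint
  have hr1 : ∀ y, ∫⁻ x, r (x, y) ∂(Measure.pi fun _ => pX) ≤ 1 := fun y => by
    rw [← hrprod]
    have := lintegral_pi_prod (fun _ : Fin n => pX)
      (F := fun i x => S.indicator (fun w => ENNReal.ofReal (φ w.2)) (x, y i))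
      fun i => hD.comp measurable_prodMk_right
    exact this.trans_le (Finset.prod_le_one' fun i _ => hle (y i))
  have hrφ : ∀ᵐ z ∂(targetJoint pX κ n), r z = ENNReal.ofReal (∏ i, φ (z.2 i)) := by
    rw [hP, ae_withDensity_iff hr]
    refine ae_of_all _ fun z hz => Set.indicator_of_mem ?_ _
    by_contra hzT
    exact hz (Set.indicator_of_notMem hzT _)
  have hlog : (fun z => Real.logb 2 (∏ i, φ (z.2 i))) =ᵐ[targetJoint pX κ n]
      fun z => Real.logb 2 (r z).toReal := by
    filter_upwards [hrφ] with z hz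
    rw [hz, ENNReal.toReal_ofReal (hposn _).le]
  have hrpos : ∀ᵐ z ∂(targetJoint pX κ n), r z ≠ 0 ∧ r z ≠ ∞ := by
    filter_upwards [hrφ] with z hz
    rw [hz]
    exact ⟨(ENNReal.ofReal_pos.2 (hposn _)).ne', ENNReal.ofReal_ne_top⟩
  have hI := integral_logb_prod n hpos hint
  set I := ∫ z, Real.logb 2 (φ z.2) ∂(pXY pX κ) with hIdef
  obtain ⟨𝒰, m, μU, hμU, f, g, hf, hg, hpre, hmap, hlen, hbound⟩ :=
    exists_scheme (Measure.pi fun _ : Fin n => pX) (Measure.pi fun _ : Fin n => pYout pX κ) hT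
      hφn hposn hP (fst_targetJoint pX κ n) (snd_targetJoint pX κ n) hintn
  have hlower : ∀ s ∈ achievableRates pX κ n, I ≤ s := by
    rintro s ⟨𝒰, m, μU, hμU, f, g, hf, hg, hpre, hmap, hlen, rfl⟩
    have := integral_logb_le_length hf hg hpre hmap hlen hr hr1 hrpos (hintn.congr hlog)
    rw [← integral_congr_ae hlog, hI] at this
    rw [one_div, ← div_eq_inv_mul, le_div_iff₀ hn']
    linarith
  have hmem : (1 / n : ℝ) * ∫ p, ((f p.1 p.2).length : ℝ)
      ∂((Measure.pi fun _ : Fin n => pX).prod μU) ∈ achievableRates pX κ n :=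
    ⟨𝒰, m, μU, hμU, f, g, hf, hg, hpre, hmap, hlen, rfl⟩
  rw [Rn_eq_sInf_achievableRates]
  constructor
  · exact le_csInf ⟨_, hmem⟩ hlower
  · refine (csInf_le ⟨I, hlower⟩ hmem).trans ?_
    rw [hI] at hbound
    rw [one_div, ← div_eq_inv_mul, div_le_iff₀ hn', add_mul, div_mul_cancel₀ _ hn'.ne']
    linarith

end MultiLetter

/-- **Achievability: sublogarithmic redundancy for singular channels.**
Let `𝒳`, `𝒴` be Polish (standard Borel) spaces, `p_X` a source and `κ = p_{Y|X}` a Markov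
kernel with finite mutual information `I(X;Y)` (so `p_{XY} ≪ p_X × p_Y`, with integrable
log-density). If the joint distribution `p_{XY}` is singular, then the minimum average rate
satisfies `lim_{n→∞} (R_n − I(X;Y)) / ((log₂ n)/n) = 0`: the redundancy of exact channel
synthesis is sublogarithmic in the blocklength. -/
theorem redundancy_singular
    (pX : Measure 𝒳) [IsProbabilityMeasure pX] (κ : Kernel 𝒳 𝒴) [IsMarkovKernel κ]
    (hac : pXY pX κ ≪ pX.prod (pYout pX κ))
    (hIfin : Integrable
      (fun z => Real.logb 2 ((pXY pX κ).rnDeriv (pX.prod (pYout pX κ)) z).toReal)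
      (pXY pX κ))
    (hsing : Singular pX κ) :
    Tendsto (fun n : ℕ => (Rn pX κ n - mutInfoBits pX κ) / (Real.logb 2 n / n))
      atTop (nhds 0) := by
  obtain ⟨S, φ, hS, hφ, hpos, h, hle, hint, hI⟩ := exists_density_of_singular hac hIfin hsing
  have hlim : Tendsto (fun n : ℕ => 9 / Real.logb 2 n) atTop (nhds 0) :=
    tendsto_const_nhds.div_atTop
      ((Real.tendsto_logb_atTop (by norm_num)).comp tendsto_natCast_atTop_atTop)
  have key : ∀ n : ℕ, 2 ≤ n → (Rn pX κ n - mutInfoBits pX κ) / (Real.logb 2 n / n) ∈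
      Set.Icc 0 (9 / Real.logb 2 n) := fun n hn => by
    have hn' : (2 : ℝ) ≤ n := by exact_mod_cast hn
    have hlog : 0 < Real.logb 2 n := Real.logb_pos (by norm_num) (by linarith)
    obtain ⟨h1, h2⟩ := Rn_mem_Icc n hS hφ hpos h hle hint (by omega)
    rw [hI] at h1 h2
    refine ⟨div_nonneg (by linarith) (by positivity), ?_⟩
    rw [div_le_iff₀ (by positivity)]
    calc Rn pX κ n - mutInfoBits pX κ ≤ 9 / n := by linarith
      _ = 9 / Real.logb 2 n * (Real.logb 2 n / n) := by field_simp
  exact squeeze_zero' ((eventually_ge_atTop 2).mono fun n hn => (key n hn).1)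
    ((eventually_ge_atTop 2).mono fun n hn => (key n hn).2) hlim

end
end

section
/- Let P_{XY} = P_X P_{Y|X} and Q_{XY} = Q_X Q_{Y|X} be probability measures on 𝒳 × 𝒴 given by marginals P_X, Q_X on 𝒳 and Markov kernels P_{Y|X}, Q_{Y|X} from 𝒳 to 𝒴. Assume P_{XY} ≪ Q_{XY} and P_{Y|X}(·|x) ≪ Q_{Y|X}(·|x) for every x ∈ 𝒳. Then for Q_{XY}-almost every (x,y), the Radon–Nikodym derivative factorizes: (dP_{XY}/dQ_{XY})(x,y) = (dP_X/dQ_X)(x) · (dP_{Y|X}/dQ_{Y|X})(y|x), where (x,y) ↦ (dP_{Y|X}/dQ_{Y|X})(y|x) is a jointly measurable version of the kernel densities. -/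
open MeasureTheory ProbabilityTheory
open scoped ProbabilityTheory

/-- **Factorization of the Radon–Nikodym derivative of joint measures.**
Let `𝒳`, `𝒴` be standard Borel (Polish) spaces, `P_X`, `Q_X` probability measures on `𝒳`,
and `P_{Y|X} = κP`, `Q_{Y|X} = κQ` Markov kernels from `𝒳` to `𝒴`, with joint measures
`P_{XY} = P_X ⊗ₘ κP` and `Q_{XY} = Q_X ⊗ₘ κQ`. Assume `P_{XY} ≪ Q_{XY}` and
`κP(·|x) ≪ κQ(·|x)` for every `x`. Then for `Q_{XY}`-almost every `(x,y)`,
`(dP_{XY}/dQ_{XY})(x,y) = (dP_X/dQ_X)(x) · (dκP/dκQ)(y|x)`, where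
`Kernel.rnDeriv κP κQ` is the jointly measurable version of the kernel densities. -/
theorem rnDeriv_compProd_factorization
    {𝒳 𝒴 : Type} [MeasurableSpace 𝒳] [StandardBorelSpace 𝒳]
    [MeasurableSpace 𝒴] [StandardBorelSpace 𝒴]
    (PX QX : Measure 𝒳) [IsProbabilityMeasure PX] [IsProbabilityMeasure QX]
    (κP κQ : Kernel 𝒳 𝒴) [IsMarkovKernel κP] [IsMarkovKernel κQ]
    (habs : (PX ⊗ₘ κP) ≪ (QX ⊗ₘ κQ))
    (habsKernel : ∀ x, κP x ≪ κQ x) :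
    ∀ᵐ z ∂(QX ⊗ₘ κQ),
      (PX ⊗ₘ κP).rnDeriv (QX ⊗ₘ κQ) z
        = PX.rnDeriv QX z.1 * Kernel.rnDeriv κP κQ z.1 z.2 := by
  have hX : PX ≪ QX := Measure.absolutelyContinuous_of_compProd habs
  have hg : Measurable fun z : 𝒳 × 𝒴 ↦ PX.rnDeriv QX z.1 * Kernel.rnDeriv κP κQ z.1 z.2 :=
    ((Measure.measurable_rnDeriv PX QX).comp measurable_fst).mul (Kernel.measurable_rnDeriv κP κQ)
  have hdensity : PX ⊗ₘ κP = (QX ⊗ₘ κQ).withDensity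
      fun z ↦ PX.rnDeriv QX z.1 * Kernel.rnDeriv κP κQ z.1 z.2 := by
    ext s hs
    rw [withDensity_apply _ hs, ← lintegral_indicator hs,
      Measure.lintegral_compProd (hg.indicator hs), Measure.compProd_apply hs,
      ← lintegral_rnDeriv_mul hX (Kernel.measurable_kernel_prodMk_left hs).aemeasurable]
    refine lintegral_congr fun x ↦ ?_
    have hsx : MeasurableSet (Prod.mk x ⁻¹' s) := measurable_prodMk_left hs
    rw [← Kernel.setLIntegral_rnDeriv (habsKernel x) hsx, ← lintegral_indicator hsx,
      ← lintegral_const_mul _ ((Kernel.measurable_rnDeriv_right κP κQ x).indicator hsx)]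
    refine lintegral_congr fun y ↦ ?_
    by_cases hy : (x, y) ∈ s <;> simp [hy]
  rw [hdensity]
  exact Measure.rnDeriv_withDensity _ hg
end

section
/- Let 𝒳 and 𝒴 be countable alphabets, p_X a distribution on 𝒳 and p_{Y|X} a channel, with joint distribution p_{XY} and output marginal p_Y. Then p_{XY} is singular (i.e. the log-likelihood ratio log₂(p_{Y|X}(Y|X)/p_Y(Y)) is almost surely a deterministic function of Y) if and only if for all y ∈ 𝒴 and all x₁, x₂ ∈ 𝒳 with p_X(x₁)p_X(x₂) > 0, p_{Y|X}(y|x₁)p_{Y|X}(y|x₂) > 0 implies p_{Y|X}(y|x₁) = p_{Y|X}(y|x₂). -/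
/-- The output marginal of a channel is positive at every output reached with positive
probability. -/
theorem output_marginal_pos {𝒳 𝒴 : Type} {pX : 𝒳 → ℝ} {pYX : 𝒳 → 𝒴 → ℝ}
    (hXnn : ∀ x, 0 ≤ pX x) (hYXnn : ∀ x y, 0 ≤ pYX x y)
    (hX : Summable pX) (hYXsum : ∀ x, ∑' y, pYX x y = 1)
    {x : 𝒳} {y : 𝒴} (h : 0 < pX x * pYX x y) :
    0 < ∑' x', pX x' * pYX x' y := by
  have hle (x' : 𝒳) : pYX x' y ≤ 1 := by
    have hs : Summable (pYX x') := by
      by_contra hns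
      simpa [tsum_eq_zero_of_not_summable hns] using hYXsum x'
    rw [← hYXsum x']
    exact hs.le_tsum y fun _ _ => hYXnn x' _
  have hs : Summable fun x' => pX x' * pYX x' y :=
    hX.of_nonneg_of_le (fun x' => mul_nonneg (hXnn x') (hYXnn x' y))
      fun x' => mul_le_of_le_one_right (hXnn x') (hle x')
  exact hs.tsum_pos (fun x' => mul_nonneg (hXnn x') (hYXnn x' y)) x h

/-- **Discrete characterization of singularity.**
Let `𝒳` and `𝒴` be countable alphabets, `p_X` a distribution on `𝒳` and `p_{Y|X}` a channel,
with joint `p_{XY}(x,y) = p_X(x) p_{Y|X}(y|x)` and output marginal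
`p_Y(y) = ∑_x p_{XY}(x,y)`. Then `p_{XY}` is singular — i.e. the log-likelihood ratio
`log₂(p_{Y|X}(Y|X)/p_Y(Y))` is almost surely (equivalently, on the support of `p_{XY}`)
a deterministic function of `Y` — if and only if for all `y` and all `x₁, x₂` with
`p_X(x₁) p_X(x₂) > 0`, `p_{Y|X}(y|x₁) p_{Y|X}(y|x₂) > 0` implies
`p_{Y|X}(y|x₁) = p_{Y|X}(y|x₂)`. -/
theorem discrete_singular_iff
    {𝒳 𝒴 : Type} [Countable 𝒳] [Countable 𝒴]
    (pX : 𝒳 → ℝ) (pYX : 𝒳 → 𝒴 → ℝ)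
    (hXnn : ∀ x, 0 ≤ pX x) (hYXnn : ∀ x y, 0 ≤ pYX x y)
    (hXsum : ∑' x, pX x = 1) (hYXsum : ∀ x, ∑' y, pYX x y = 1) :
    (∃ φ : 𝒴 → ℝ, ∀ x y, 0 < pX x * pYX x y →
        Real.logb 2 (pYX x y / ∑' x', pX x' * pYX x' y) = φ y)
      ↔ (∀ (y : 𝒴) (x₁ x₂ : 𝒳), 0 < pX x₁ * pX x₂ →
          0 < pYX x₁ y * pYX x₂ y → pYX x₁ y = pYX x₂ y) := by
  constructor
  · rintro ⟨φ, hφ⟩ y x₁ x₂ hX hY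
    have hX₁ : 0 < pX x₁ := pos_of_mul_pos_left hX (hXnn x₂)
    have hX₂ : 0 < pX x₂ := pos_of_mul_pos_right hX (hXnn x₁)
    have hY₁ : 0 < pYX x₁ y := pos_of_mul_pos_left hY (hYXnn x₂ y)
    have hY₂ : 0 < pYX x₂ y := pos_of_mul_pos_right hY (hYXnn x₁ y)
    have hXs : Summable pX := by
      by_contra hns
      simp [tsum_eq_zero_of_not_summable hns] at hXsum
    have hpos := output_marginal_pos hXnn hYXnn hXs hYXsum (mul_pos hX₁ hY₁)
    have heq := (hφ x₁ y (mul_pos hX₁ hY₁)).trans (hφ x₂ y (mul_pos hX₂ hY₂)).symm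
    exact (div_left_inj' hpos.ne').mp <|
      Real.logb_injOn_pos one_lt_two (div_pos hY₁ hpos) (div_pos hY₂ hpos) heq
  · intro h
    have hφ (y : 𝒴) : ∃ c : ℝ, ∀ x, 0 < pX x * pYX x y →
        Real.logb 2 (pYX x y / ∑' x', pX x' * pYX x' y) = c := by
      by_cases hy : ∃ x₀, 0 < pX x₀ * pYX x₀ y
      · obtain ⟨x₀, h₀⟩ := hy
        refine ⟨Real.logb 2 (pYX x₀ y / ∑' x', pX x' * pYX x' y), fun x hx => ?_⟩
        rw [h y x x₀
          (mul_pos (pos_of_mul_pos_left hx (hYXnn x y)) (pos_of_mul_pos_left h₀ (hYXnn x₀ y)))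
          (mul_pos (pos_of_mul_pos_right hx (hXnn x)) (pos_of_mul_pos_right h₀ (hXnn x₀)))]
      · exact ⟨0, fun x hx => absurd ⟨x, hx⟩ hy⟩
    choose φ hφ using hφ
    exact ⟨φ, fun x y => hφ y x⟩
end

section
/- Let 𝒜 be a finite alphabet and let X₁, …, X_n be i.i.d. with distribution p on 𝒜, and let T(X^n) = (t(X^n, a))_{a ∈ 𝒜} with t(X^n, a) = (1/n)|{j : X_j = a}| be the empirical type of X^n. Then there exists a constant c depending only on p (not on n) such that for all n ≥ 1, H(T(X^n)) ≤ ((|𝒜| − 1)/2) log₂ n + c. -/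
open scoped BigOperators

/-- Binary (base-2) entropy contribution of a probability value `t`:
`ent2 t = -(t * log₂ t)` (with the convention `log₂ 0 = 0`). -/
noncomputable def ent2 (t : ℝ) : ℝ := -(t * Real.logb 2 t)

/-- The probability, under the i.i.d. product of `p` on `𝒜ⁿ`, that the empirical type of
`X^n` has count vector `cnt` (i.e. `|{j : X_j = a}| = cnt a` for every `a`); since for a fixed
blocklength `n` the count vector and the empirical type determine each other, this is the pmf
of the type `T(X^n)`. -/
noncomputable def typeProb {𝒜 : Type} [Fintype 𝒜] [DecidableEq 𝒜]
    (p : 𝒜 → ℝ) (n : ℕ) (cnt : 𝒜 → ℕ) : ℝ :=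
  ∑ y : Fin n → 𝒜,
    if ∀ a, (Finset.univ.filter fun j => y j = a).card = cnt a then ∏ i, p (y i) else 0

open Finset in
/-- The count vector of a word. -/
def wordCount {𝒜 : Type} [DecidableEq 𝒜] {n : ℕ} (y : Fin n → 𝒜) (a : 𝒜) : ℕ :=
  (univ.filter fun j => y j = a).card

open Finset in
theorem wordCount_le {𝒜 : Type} [DecidableEq 𝒜] {n : ℕ} (y : Fin n → 𝒜) (a : 𝒜) :
    wordCount y a ≤ n :=
  (card_filter_le _ _).trans (by simp)

open Finset in
theorem sum_wordCount {𝒜 : Type} [Fintype 𝒜] [DecidableEq 𝒜] {n : ℕ} (y : Fin n → 𝒜) :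
    ∑ a, wordCount y a = n := by
  have := card_eq_sum_card_fiberwise (f := y) (s := univ) (t := univ) (by simp)
  simpa [wordCount] using this.symm

theorem typeProb_eq_sum_ite_wordCount {𝒜 : Type} [Fintype 𝒜] [DecidableEq 𝒜]
    (p : 𝒜 → ℝ) (n : ℕ) (cnt : 𝒜 → ℕ) :
    typeProb p n cnt = ∑ y : Fin n → 𝒜, if wordCount y = cnt then ∏ i, p (y i) else 0 := by
  simp only [typeProb, funext_iff, wordCount]

open Finset in
theorem sum_typeProb_mul {𝒜 : Type} [Fintype 𝒜] [DecidableEq 𝒜]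
    (p : 𝒜 → ℝ) (n : ℕ) (f : (𝒜 → ℕ) → ℝ) :
    ∑ cnt ∈ univ.image (wordCount (𝒜 := 𝒜) (n := n)), typeProb p n cnt * f cnt =
      ∑ y : Fin n → 𝒜, (∏ i, p (y i)) * f (wordCount y) := by
  simp only [typeProb_eq_sum_ite_wordCount, sum_mul, ite_mul, zero_mul]
  rw [sum_comm]
  refine sum_congr rfl fun y _ => ?_
  rw [sum_ite_eq, if_pos (mem_image_of_mem _ (mem_univ _))]

theorem sum_prod_word_eq_one {𝒜 : Type} [Fintype 𝒜] [DecidableEq 𝒜]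
    (p : 𝒜 → ℝ) (hsum : ∑ a, p a = 1) (n : ℕ) :
    ∑ y : Fin n → 𝒜, ∏ i, p (y i) = 1 := by
  rw [← Fintype.prod_sum fun _ : Fin n => p]
  simp [hsum]

theorem sum_word_succ {𝒜 : Type} [Fintype 𝒜] (n : ℕ) (F : (Fin (n + 1) → 𝒜) → ℝ) :
    ∑ y, F y = ∑ x, ∑ y : Fin n → 𝒜, F (Fin.cons x y) := by
  rw [← (Fin.consEquiv fun _ : Fin (n + 1) => 𝒜).sum_comp, Fintype.sum_prod_type]
  rfl

/-- First and second moments of a sum of i.i.d. centred variables. -/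
theorem moments_sum_word {𝒜 : Type} [Fintype 𝒜] [DecidableEq 𝒜]
    (p g : 𝒜 → ℝ) (hsum : ∑ a, p a = 1) (hg : ∑ a, p a * g a = 0) (n : ℕ) :
    (∑ y : Fin n → 𝒜, (∏ i, p (y i)) * ∑ i, g (y i) = 0) ∧
    (∑ y : Fin n → 𝒜, (∏ i, p (y i)) * (∑ i, g (y i)) ^ 2 = n * ∑ a, p a * g a ^ 2) := by
  induction n with
  | zero => simp
  | succ n ih =>
    obtain ⟨ih1, ih2⟩ := ih
    have h1 := sum_prod_word_eq_one p hsum n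
    simp only [sum_word_succ, Fin.prod_univ_succ, Fin.sum_univ_succ, Fin.cons_zero, Fin.cons_succ]
    constructor
    · have : ∀ x, ∑ y : Fin n → 𝒜, (p x * ∏ i, p (y i)) * (g x + ∑ i, g (y i)) =
          p x * g x * (∑ y : Fin n → 𝒜, ∏ i, p (y i)) +
            p x * ∑ y : Fin n → 𝒜, (∏ i, p (y i)) * ∑ i, g (y i) := fun x => by
        simp only [Finset.mul_sum (s := (Finset.univ : Finset (Fin n → 𝒜))),
          ← Finset.sum_add_distrib]
        exact Finset.sum_congr rfl fun y _ => by ring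
      simp only [this, h1, ih1, mul_one, mul_zero, add_zero, hg]
    · have : ∀ x, ∑ y : Fin n → 𝒜, (p x * ∏ i, p (y i)) * (g x + ∑ i, g (y i)) ^ 2 =
          p x * g x ^ 2 * (∑ y : Fin n → 𝒜, ∏ i, p (y i)) +
            2 * (p x * g x) * (∑ y : Fin n → 𝒜, (∏ i, p (y i)) * ∑ i, g (y i)) +
            p x * ∑ y : Fin n → 𝒜, (∏ i, p (y i)) * (∑ i, g (y i)) ^ 2 := fun x => by
        simp only [Finset.mul_sum (s := (Finset.univ : Finset (Fin n → 𝒜))),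
          ← Finset.sum_add_distrib]
        exact Finset.sum_congr rfl fun y _ => by ring
      simp only [this, h1, ih1, ih2, mul_one, mul_zero, add_zero, Finset.sum_add_distrib,
        ← Finset.sum_mul, hsum]
      push_cast
      ring

theorem le_one_of_sum_eq_one {𝒜 : Type} [Fintype 𝒜] {p : 𝒜 → ℝ}
    (hnn : ∀ a, 0 ≤ p a) (hsum : ∑ a, p a = 1) (a : 𝒜) : p a ≤ 1 :=
  hsum ▸ Finset.single_le_sum (fun b _ => hnn b) (Finset.mem_univ a)

theorem variance_wordCount_le {𝒜 : Type} [Fintype 𝒜] [DecidableEq 𝒜]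
    (p : 𝒜 → ℝ) (hnn : ∀ a, 0 ≤ p a) (hsum : ∑ a, p a = 1) (n : ℕ) (a : 𝒜) :
    ∑ y : Fin n → 𝒜, (∏ i, p (y i)) * ((wordCount y a : ℝ) - n * p a) ^ 2 ≤ n := by
  have h1 : p a ≤ 1 := le_one_of_sum_eq_one hnn hsum a
  have hg : ∑ b, p b * ((if b = a then 1 else 0) - p a) = 0 := by
    simp [mul_sub, Finset.sum_sub_distrib, ← Finset.sum_mul, hsum]
  have hS : ∀ y : Fin n → 𝒜,
      (wordCount y a : ℝ) - n * p a = ∑ i, ((if y i = a then (1 : ℝ) else 0) - p a) := fun y => by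
    simp [wordCount, Finset.sum_sub_distrib]
  simp only [hS]
  rw [(moments_sum_word p _ hsum hg n).2]
  refine mul_le_of_le_one_right n.cast_nonneg ?_
  rw [← hsum]
  refine Finset.sum_le_sum fun b _ => mul_le_of_le_one_right (hnn b) ?_
  have := hnn a
  split_ifs <;> nlinarith

theorem sum_pow_le_of_injOn {r : ℝ} (hr0 : 0 ≤ r) (hr1 : r < 1) (s : Finset ℕ) (e : ℕ → ℕ)
    (he : Set.InjOn e s) : ∑ k ∈ s, r ^ e k ≤ (1 - r)⁻¹ := by
  rw [← Finset.sum_image (f := fun j => r ^ j) he, ← tsum_geometric_of_lt_one hr0 hr1]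
  exact (summable_geometric_of_lt_one hr0 hr1).sum_le_tsum _ fun _ _ => pow_nonneg hr0 _

/-- Two-sided geometric sums; the exponent is the distance between `k` and `m`. -/
theorem sum_pow_dist_le {r : ℝ} (hr0 : 0 ≤ r) (hr1 : r < 1) (s : Finset ℕ) (m : ℕ) :
    ∑ k ∈ s, r ^ ((k - m) + (m - k)) ≤ 2 * (1 - r)⁻¹ := by
  rw [← Finset.sum_filter_add_sum_filter_not s (m ≤ ·), two_mul]
  refine add_le_add (sum_pow_le_of_injOn hr0 hr1 _ _ ?_) (sum_pow_le_of_injOn hr0 hr1 _ _ ?_)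
  all_goals
    intro a ha b hb hab
    simp only [Finset.coe_filter, Set.mem_ofPred_eq] at ha hb hab
    omega

/-- A discrete Laplace weight of scale `√n` centred at `⌊n t⌋`, up to normalisation. -/
noncomputable def laplaceWeight (n : ℕ) (t : ℝ) (k : ℕ) : ℝ :=
  (√n / (√n + 1)) ^ ((k - ⌊n * t⌋₊) + (⌊n * t⌋₊ - k)) / √n

theorem laplaceWeight_pos {n : ℕ} (hn : 1 ≤ n) (t : ℝ) (k : ℕ) : 0 < laplaceWeight n t k := by
  have : 0 < √(n : ℝ) := Real.sqrt_pos.2 (by exact_mod_cast hn)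
  unfold laplaceWeight
  positivity

theorem sum_laplaceWeight_le {n : ℕ} (hn : 1 ≤ n) (t : ℝ) (s : Finset ℕ) :
    ∑ k ∈ s, laplaceWeight n t k ≤ 4 := by
  have h1 : 1 ≤ √(n : ℝ) := Real.one_le_sqrt.2 (by exact_mod_cast hn)
  have h0 : 0 < √(n : ℝ) := by linarith
  have hr : √(n : ℝ) / (√n + 1) < 1 := by rw [div_lt_one (by linarith)]; linarith
  unfold laplaceWeight
  rw [← Finset.sum_div, div_le_iff₀ h0]
  refine (sum_pow_dist_le (by positivity) hr s _).trans ?_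
  have : 1 - √(n : ℝ) / (√n + 1) = (√n + 1)⁻¹ := by field_simp; ring
  rw [this, inv_inv]
  linarith

theorem neg_log_laplaceWeight_le {n : ℕ} (hn : 1 ≤ n) {t : ℝ} (ht : 0 ≤ t) (k : ℕ) :
    -Real.log (laplaceWeight n t k) ≤
      Real.log n / 2 + 3 / 2 + (k - n * t) ^ 2 / (2 * n) := by
  have hn' : (1 : ℝ) ≤ n := by exact_mod_cast hn
  have h1 : 1 ≤ √(n : ℝ) := Real.one_le_sqrt.2 hn'
  have h0 : 0 < √(n : ℝ) := by linarith
  set m := ⌊(n : ℝ) * t⌋₊ with hm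
  have hm1 : (m : ℝ) ≤ n * t := Nat.floor_le (by positivity)
  have hm2 : (n : ℝ) * t < m + 1 := Nat.lt_floor_add_one _
  have he : (((k - m) + (m - k) : ℕ) : ℝ) ≤ |k - n * t| + 1 := by
    rcases le_total m k with h | h
    · rw [Nat.sub_eq_zero_of_le h, add_zero, Nat.cast_sub h]
      linarith [le_abs_self (k - n * t)]
    · rw [Nat.sub_eq_zero_of_le h, zero_add, Nat.cast_sub h]
      linarith [neg_le_abs (k - n * t)]
  have hlog : -Real.log (√n / (√n + 1)) ≤ 1 / √n := by
    rw [← Real.log_inv, inv_div]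
    refine (Real.log_le_sub_one_of_pos (by positivity)).trans (le_of_eq ?_)
    field_simp
    ring
  have hmain : (((k - m) + (m - k) : ℕ) : ℝ) * -Real.log (√n / (√n + 1)) ≤
      (|k - n * t| + 1) * (1 / √n) :=
    (mul_le_mul_of_nonneg_left hlog (Nat.cast_nonneg _)).trans
      (mul_le_mul_of_nonneg_right he (by positivity))
  have hu : (|k - n * t| + 1) * (1 / √n) = |k - n * t| / √n + 1 / √n := by ring
  have hinv : 1 / √(n : ℝ) ≤ 1 := by rw [div_le_one h0]; exact h1
  have hsq : (|k - n * t| / √n) ^ 2 = (k - n * t) ^ 2 / n := by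
    rw [div_pow, sq_abs, Real.sq_sqrt (by linarith)]
  have hhalf : (k - n * t) ^ 2 / (2 * n) = (k - n * t) ^ 2 / n / 2 := by ring
  rw [laplaceWeight, Real.log_div (by positivity) (by positivity), Real.log_pow,
    Real.log_sqrt (by linarith), hhalf, ← hsq]
  nlinarith [sq_nonneg (|k - n * t| / √n - 1)]

/-- Gibbs' inequality for an unnormalised reference weight. -/
theorem negMulLog_le {P Q : ℝ} (hP : 0 ≤ P) (hQ : 0 < Q) :
    Real.negMulLog P ≤ P * -Real.log Q + Q - P := by
  rcases hP.eq_or_lt with rfl | hP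
  · simp [hQ.le]
  · have h := mul_le_mul_of_nonneg_left (Real.log_le_sub_one_of_pos (div_pos hQ hP)) hP.le
    rw [Real.log_div hQ.ne' hP.ne', mul_sub, mul_sub, mul_div_cancel₀ _ hP.ne'] at h
    rw [Real.negMulLog]
    linarith

open Finset in
theorem sum_prod_laplaceWeight_le {𝒜 : Type} [Fintype 𝒜] [DecidableEq 𝒜] (p : 𝒜 → ℝ) (a₀ : 𝒜)
    {n : ℕ} (hn : 1 ≤ n) :
    ∑ cnt ∈ univ.image (wordCount (𝒜 := 𝒜) (n := n)),
      ∏ j : {a // a ≠ a₀}, laplaceWeight n (p j) (cnt j) ≤ 4 ^ Fintype.card {a // a ≠ a₀} := by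
  let R : (𝒜 → ℕ) → ({a // a ≠ a₀} → ℕ) := fun cnt j => cnt j
  have hR : Set.InjOn R (univ.image (wordCount (𝒜 := 𝒜) (n := n))) := by
    intro c hc c' hc' h
    simp only [coe_image, coe_univ, Set.image_univ, Set.mem_range] at hc hc'
    obtain ⟨y, rfl⟩ := hc
    obtain ⟨y', rfl⟩ := hc'
    have hne : ∀ a, a ≠ a₀ → wordCount y a = wordCount y' a := fun a ha => congrFun h ⟨a, ha⟩
    funext a
    by_cases ha : a = a₀
    · subst ha
      have e := (sum_wordCount y).trans (sum_wordCount y').symm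
      rw [← add_sum_erase _ _ (mem_univ a), ← add_sum_erase _ _ (mem_univ a),
        sum_congr rfl fun b hb => hne b (ne_of_mem_erase hb)] at e
      exact Nat.add_right_cancel e
    · exact hne a ha
  rw [← sum_image (g := R)
    (f := fun c => ∏ j : {a // a ≠ a₀}, laplaceWeight n (p j) (c j)) hR]
  calc _ ≤ ∑ c ∈ Fintype.piFinset fun _ : {a // a ≠ a₀} => range (n + 1),
        ∏ j : {a // a ≠ a₀}, laplaceWeight n (p j) (c j) := by
        refine sum_le_sum_of_subset_of_nonneg ?_
          fun c _ _ => prod_nonneg fun j _ => (laplaceWeight_pos hn _ _).le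
        intro c hc
        simp only [mem_image, mem_univ, true_and] at hc
        obtain ⟨_, ⟨y, rfl⟩, rfl⟩ := hc
        exact Fintype.mem_piFinset.2 fun j => mem_range.2 (Nat.lt_succ_of_le (wordCount_le y j))
    _ = ∏ j : {a // a ≠ a₀}, ∑ k ∈ range (n + 1), laplaceWeight n (p j) k :=
        (prod_univ_sum _ _).symm
    _ ≤ ∏ _j : {a // a ≠ a₀}, 4 :=
        prod_le_prod (fun j _ => sum_nonneg fun k _ => (laplaceWeight_pos hn _ _).le)
          fun j _ => sum_laplaceWeight_le hn _ _
    _ = _ := by rw [prod_const, card_univ]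

open Finset in
theorem expected_neg_log_le {𝒜 : Type} [Fintype 𝒜] [DecidableEq 𝒜]
    (p : 𝒜 → ℝ) (hnn : ∀ a, 0 ≤ p a) (hsum : ∑ a, p a = 1) {n : ℕ} (hn : 1 ≤ n) (a : 𝒜) :
    ∑ y : Fin n → 𝒜, (∏ i, p (y i)) * -Real.log (laplaceWeight n (p a) (wordCount y a)) ≤
      Real.log n / 2 + 2 := by
  have hn0 : (0 : ℝ) < n := by exact_mod_cast hn
  calc _ ≤ ∑ y : Fin n → 𝒜, (∏ i, p (y i)) *
        (Real.log n / 2 + 3 / 2 + ((wordCount y a : ℝ) - n * p a) ^ 2 / (2 * n)) :=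
        sum_le_sum fun y _ => mul_le_mul_of_nonneg_left (neg_log_laplaceWeight_le hn (hnn a) _)
          (prod_nonneg fun i _ => hnn _)
    _ = (Real.log n / 2 + 3 / 2) +
        (∑ y : Fin n → 𝒜, (∏ i, p (y i)) * ((wordCount y a : ℝ) - n * p a) ^ 2) / (2 * n) := by
        simp only [mul_add, sum_add_distrib, ← sum_mul, sum_prod_word_eq_one p hsum, sum_div,
          mul_div_assoc, one_mul]
    _ ≤ (Real.log n / 2 + 3 / 2) + n / (2 * n) := by
        gcongr
        exact variance_wordCount_le p hnn hsum n a
    _ = _ := by field_simp; ring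

open Finset in
theorem sum_negMulLog_typeProb_le {𝒜 : Type} [Fintype 𝒜] [DecidableEq 𝒜]
    (p : 𝒜 → ℝ) (hnn : ∀ a, 0 ≤ p a) (hsum : ∑ a, p a = 1) (a₀ : 𝒜) {n : ℕ} (hn : 1 ≤ n) :
    ∑ cnt ∈ univ.image (wordCount (𝒜 := 𝒜) (n := n)), Real.negMulLog (typeProb p n cnt) ≤
      Fintype.card {a // a ≠ a₀} * (Real.log n / 2 + 2) + 4 ^ Fintype.card {a // a ≠ a₀} := by
  have hP : ∀ cnt, 0 ≤ typeProb p n cnt := fun cnt =>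
    sum_nonneg fun y _ => by
      split_ifs
      exacts [prod_nonneg fun i _ => hnn _, le_rfl]
  have hone : ∑ cnt ∈ univ.image (wordCount (𝒜 := 𝒜) (n := n)), typeProb p n cnt = 1 := by
    simpa [sum_prod_word_eq_one p hsum] using sum_typeProb_mul p n fun _ => 1
  set Q : (𝒜 → ℕ) → ℝ := fun cnt => ∏ j : {a // a ≠ a₀}, laplaceWeight n (p j) (cnt j)
  have hcross : ∑ cnt ∈ univ.image (wordCount (𝒜 := 𝒜) (n := n)),
      typeProb p n cnt * -Real.log (Q cnt) ≤
        Fintype.card {a // a ≠ a₀} * (Real.log n / 2 + 2) := by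
    rw [sum_typeProb_mul p n fun c => -Real.log (Q c)]
    have hlog : ∀ c, -Real.log (Q c) =
        ∑ j : {a // a ≠ a₀}, -Real.log (laplaceWeight n (p j) (c j)) := fun c => by
      rw [Real.log_prod fun j _ => (laplaceWeight_pos hn _ _).ne', sum_neg_distrib]
    simp only [hlog, mul_sum]
    rw [sum_comm, ← nsmul_eq_mul]
    exact sum_le_card_nsmul _ _ _ fun j _ => expected_neg_log_le p hnn hsum hn j
  have hgibbs := sum_le_sum fun cnt (_ : cnt ∈ univ.image (wordCount (𝒜 := 𝒜) (n := n))) =>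
    negMulLog_le (hP cnt)
      (prod_pos fun j _ => laplaceWeight_pos hn _ _ : 0 < Q cnt)
  rw [sum_sub_distrib, sum_add_distrib, hone] at hgibbs
  linarith [sum_prod_laplaceWeight_le p a₀ hn]

theorem ent2_eq_negMulLog_div (t : ℝ) : ent2 t = Real.negMulLog t / Real.log 2 := by
  rw [ent2, Real.negMulLog, Real.logb]
  ring

/-- **Entropy of the empirical type.**
Let `𝒜` be a finite alphabet and `X₁, …, X_n` i.i.d. with distribution `p` on `𝒜`, and let
`T(X^n)` be the empirical type of `X^n`. Then there exists a constant `c` depending only on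
`p` (not on `n`) such that for all `n ≥ 1`,
`H(T(X^n)) ≤ ((|𝒜| − 1)/2) log₂ n + c` (entropy in bits). -/
theorem type_entropy_le
    {𝒜 : Type} [Fintype 𝒜] [DecidableEq 𝒜]
    (p : 𝒜 → ℝ) (hnn : ∀ a, 0 ≤ p a) (hsum : ∑ a, p a = 1) :
    ∃ c : ℝ, ∀ n : ℕ, 1 ≤ n →
      (∑' cnt : 𝒜 → ℕ, ent2 (typeProb p n cnt)) ≤
        ((Fintype.card 𝒜 - 1 : ℝ) / 2) * Real.logb 2 n + c := by
  obtain ⟨a₀⟩ : Nonempty 𝒜 := by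
    by_contra h
    rw [not_nonempty_iff] at h
    simp at hsum
  refine ⟨(Fintype.card {a // a ≠ a₀} * 2 + 4 ^ Fintype.card {a // a ≠ a₀}) / Real.log 2,
    fun n hn => ?_⟩
  have hsupp : ∀ cnt ∉ Finset.univ.image (wordCount (𝒜 := 𝒜) (n := n)),
      ent2 (typeProb p n cnt) = 0 := fun cnt h => by
    have h0 : typeProb p n cnt = 0 := by
      rw [typeProb_eq_sum_ite_wordCount]
      refine Finset.sum_eq_zero fun y _ => if_neg ?_
      rintro rfl
      exact h (Finset.mem_image_of_mem _ (Finset.mem_univ _))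
    simp [ent2, h0]
  have hcard : (Fintype.card {a // a ≠ a₀} : ℝ) = Fintype.card 𝒜 - 1 := by
    rw [Fintype.card_subtype_compl, Fintype.card_subtype_eq,
      Nat.cast_sub (Fintype.card_pos_iff.2 ⟨a₀⟩), Nat.cast_one]
  have hlog : 0 < Real.log 2 := Real.log_pos one_lt_two
  rw [tsum_eq_sum fun cnt h => hsupp cnt h]
  simp only [ent2_eq_negMulLog_div]
  rw [← Finset.sum_div, ← hcard, Real.logb]
  calc _ ≤ _ := div_le_div_of_nonneg_right (sum_negMulLog_typeProb_le p hnn hsum a₀ hn) hlog.le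
    _ = _ := by ring
end

section
/- Let 𝒜 be a finite alphabet and p a probability distribution on 𝒜 with full support, and let Y₁, …, Y_n be i.i.d. with law p. Let R = T(Y^n) denote the empirical type of Y^n. Then there exists a constant C depending only on p such that for all n ≥ 1, E[H(R)] ≥ H(p) − C/n, where H(R) is the entropy of the (random) empirical distribution R. -/
open scoped BigOperators

/-- Shannon entropy (in bits) of a distribution `q` on a finite alphabet `𝒜`. -/
noncomputable def Hq {𝒜 : Type} [Fintype 𝒜] (q : 𝒜 → ℝ) : ℝ := ∑ a, ent2 (q a)

/-- The empirical type (empirical distribution) of a sequence `y : Fin n → 𝒜`. -/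
noncomputable def empDist {𝒜 : Type} [Fintype 𝒜] [DecidableEq 𝒜] {n : ℕ}
    (y : Fin n → 𝒜) (a : 𝒜) : ℝ :=
  ((Finset.univ.filter fun j => y j = a).card : ℝ) / n

lemma sum_prod_mul_succ {𝒜 : Type} [Fintype 𝒜] (p : 𝒜 → ℝ) {n : ℕ}
    (F : (Fin (n + 1) → 𝒜) → ℝ) :
    ∑ y : Fin (n + 1) → 𝒜, (∏ i, p (y i)) * F y =
      ∑ b, p b * ∑ y : Fin n → 𝒜, (∏ i, p (y i)) * F (Fin.cons b y) := by
  rw [← (Fin.consEquiv fun _ : Fin (n + 1) => 𝒜).sum_comp, Fintype.sum_prod_type]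
  simp [Fin.consEquiv, Fin.prod_univ_succ, Finset.mul_sum, mul_assoc]

lemma sum_prod_eq_one {𝒜 : Type} [Fintype 𝒜] {p : 𝒜 → ℝ} (hsum : ∑ a, p a = 1) (n : ℕ) :
    ∑ y : Fin n → 𝒜, ∏ i, p (y i) = 1 := by
  classical
  rw [← Fintype.piFinset_univ, Finset.sum_prod_piFinset]
  simp [hsum]

/-- The mean of a sum of i.i.d. random variables. -/
lemma sum_prod_mul_sum {𝒜 : Type} [Fintype 𝒜] {p : 𝒜 → ℝ} (hsum : ∑ a, p a = 1)
    (g : 𝒜 → ℝ) (n : ℕ) :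
    ∑ y : Fin n → 𝒜, (∏ i, p (y i)) * ∑ j, g (y j) = n * ∑ a, p a * g a := by
  induction n with
  | zero => simp
  | succ n ih =>
    rw [sum_prod_mul_succ]
    simp only [Fin.sum_univ_succ, Fin.cons_zero, Fin.cons_succ, mul_add, Finset.sum_add_distrib,
      ih, ← Finset.sum_mul, sum_prod_eq_one hsum, hsum, one_mul]
    rw [Nat.cast_succ, add_one_mul, add_comm]

/-- The second moment of a sum of i.i.d. random variables. -/
lemma sum_prod_mul_sum_sq {𝒜 : Type} [Fintype 𝒜] {p : 𝒜 → ℝ} (hsum : ∑ a, p a = 1)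
    (g : 𝒜 → ℝ) (n : ℕ) :
    ∑ y : Fin n → 𝒜, (∏ i, p (y i)) * (∑ j, g (y j)) ^ 2 =
      n * ∑ a, p a * g a ^ 2 + n * (n - 1) * (∑ a, p a * g a) ^ 2 := by
  induction n with
  | zero => simp
  | succ n ih =>
    have expand (b : 𝒜) : ∑ y : Fin n → 𝒜, (∏ i, p (y i)) * (g b + ∑ j, g (y j)) ^ 2 =
        g b ^ 2 + 2 * g b * (n * ∑ a, p a * g a) +
          (n * ∑ a, p a * g a ^ 2 + n * (n - 1) * (∑ a, p a * g a) ^ 2) := by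
      rw [← ih, ← sum_prod_mul_sum hsum, ← mul_one (g b ^ 2), ← sum_prod_eq_one hsum n,
        Finset.mul_sum, Finset.mul_sum, ← Finset.sum_add_distrib, ← Finset.sum_add_distrib]
      exact Finset.sum_congr rfl fun y _ => by ring
    have cross (c : ℝ) : ∑ b, p b * (2 * g b * c) = 2 * c * ∑ b, p b * g b := by
      rw [Finset.mul_sum]
      exact Finset.sum_congr rfl fun b _ => by ring
    rw [sum_prod_mul_succ]
    simp only [Fin.sum_univ_succ, Fin.cons_zero, Fin.cons_succ, expand]
    simp only [mul_add (p _), Finset.sum_add_distrib, cross, ← Finset.sum_mul, hsum]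
    push_cast
    ring

lemma empDist_eq_sum {𝒜 : Type} [Fintype 𝒜] [DecidableEq 𝒜] {n : ℕ} (y : Fin n → 𝒜) (a : 𝒜) :
    empDist y a = (∑ j, if y j = a then (1 : ℝ) else 0) / n := by
  simp [empDist]

lemma sum_prod_mul_empDist {𝒜 : Type} [Fintype 𝒜] [DecidableEq 𝒜] {p : 𝒜 → ℝ}
    (hsum : ∑ a, p a = 1) {n : ℕ} (hn : n ≠ 0) (a : 𝒜) :
    ∑ y : Fin n → 𝒜, (∏ i, p (y i)) * empDist y a = p a := by
  have h := sum_prod_mul_sum hsum (fun b => if b = a then (1 : ℝ) else 0) n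
  simp only [empDist_eq_sum, ← mul_div_assoc, ← Finset.sum_div, h]
  simp [hn]

lemma sum_prod_mul_empDist_sq {𝒜 : Type} [Fintype 𝒜] [DecidableEq 𝒜] {p : 𝒜 → ℝ}
    (hsum : ∑ a, p a = 1) {n : ℕ} (hn : n ≠ 0) (a : 𝒜) :
    ∑ y : Fin n → 𝒜, (∏ i, p (y i)) * empDist y a ^ 2 = p a ^ 2 + p a * (1 - p a) / n := by
  have h := sum_prod_mul_sum_sq hsum (fun b => if b = a then (1 : ℝ) else 0) n
  simp only [empDist_eq_sum, div_pow, ← mul_div_assoc, ← Finset.sum_div, h]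
  have hn' : (n : ℝ) ≠ 0 := by exact_mod_cast hn
  simp only [ite_pow, one_pow, ne_eq, OfNat.ofNat_ne_zero, not_false_eq_true, zero_pow, mul_ite,
    mul_one, mul_zero, Finset.sum_ite_eq', Finset.mem_univ, if_true]
  field_simp
  ring

/-- A quadratic lower bound for the entropy contribution, from `log (t / q) ≤ t / q - 1`. -/
lemma ent2_ge {q t : ℝ} (hq : 0 < q) (ht : 0 ≤ t) :
    t * ((1 - Real.log q) / Real.log 2) - t ^ 2 * (1 / (q * Real.log 2)) ≤ ent2 t := by
  have hlog2 : 0 < Real.log 2 := Real.log_pos one_lt_two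
  rcases ht.eq_or_lt with rfl | ht
  · simp [ent2]
  have hlog := Real.log_le_sub_one_of_pos (div_pos ht hq)
  rw [Real.log_div ht.ne' hq.ne'] at hlog
  calc t * ((1 - Real.log q) / Real.log 2) - t ^ 2 * (1 / (q * Real.log 2))
      = t * (1 - Real.log q - t / q) / Real.log 2 := by field_simp
    _ ≤ t * (-Real.log t) / Real.log 2 := by
        gcongr
        linarith
    _ = ent2 t := by rw [ent2, Real.logb]; ring

lemma ent2_sub_le_sum_prod_mul_ent2_empDist {𝒜 : Type} [Fintype 𝒜] [DecidableEq 𝒜]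
    {p : 𝒜 → ℝ} (hpos : ∀ a, 0 < p a) (hsum : ∑ a, p a = 1) {n : ℕ} (hn : n ≠ 0) (a : 𝒜) :
    ent2 (p a) - (1 - p a) / Real.log 2 / n ≤
      ∑ y : Fin n → 𝒜, (∏ i, p (y i)) * ent2 (empDist y a) := by
  have hlog2 : Real.log 2 ≠ 0 := (Real.log_pos one_lt_two).ne'
  have hp := (hpos a).ne'
  have hn' : (n : ℝ) ≠ 0 := by exact_mod_cast hn
  calc ent2 (p a) - (1 - p a) / Real.log 2 / n
      = p a * ((1 - Real.log (p a)) / Real.log 2) -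
          (p a ^ 2 + p a * (1 - p a) / n) * (1 / (p a * Real.log 2)) := by
        rw [ent2, Real.logb]
        field_simp
        ring
    _ = ∑ y : Fin n → 𝒜, (∏ i, p (y i)) * (empDist y a * ((1 - Real.log (p a)) / Real.log 2) -
          empDist y a ^ 2 * (1 / (p a * Real.log 2))) := by
        simp only [mul_sub, ← mul_assoc (∏ i, p _), Finset.sum_sub_distrib, ← Finset.sum_mul,
          sum_prod_mul_empDist hsum hn, sum_prod_mul_empDist_sq hsum hn]
    _ ≤ _ := Finset.sum_le_sum fun y _ =>
        mul_le_mul_of_nonneg_left (ent2_ge (hpos a) (by unfold empDist; positivity))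
          (Finset.prod_nonneg fun i _ => (hpos _).le)

/-- **Expected entropy of the empirical type.**
Let `𝒜` be a finite alphabet and `p` a full-support distribution on `𝒜`, and let
`Y₁, …, Y_n` be i.i.d. with law `p` (the expectation below is written as the finite sum over
all sequences `y ∈ 𝒜ⁿ`, weighted by `∏ᵢ p(yᵢ)`). Then there is a constant `C` depending only
on `p` such that for all `n ≥ 1`, `E[H(T(Y^n))] ≥ H(p) − C/n`. -/
theorem expected_type_entropy_ge
    {𝒜 : Type} [Fintype 𝒜] [DecidableEq 𝒜]
    (p : 𝒜 → ℝ) (hpos : ∀ a, 0 < p a) (hsum : ∑ a, p a = 1) :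
    ∃ C : ℝ, ∀ n : ℕ, 1 ≤ n →
      Hq p - C / n ≤
        ∑ y : Fin n → 𝒜, (∏ i, p (y i)) * Hq (empDist y) := by
  refine ⟨∑ a, (1 - p a) / Real.log 2, fun n hn => ?_⟩
  simp only [Hq, Finset.mul_sum, Finset.sum_div]
  rw [Finset.sum_comm, ← Finset.sum_sub_distrib]
  exact Finset.sum_le_sum fun a _ =>
    ent2_sub_le_sum_prod_mul_ent2_empDist hpos hsum (Nat.one_le_iff_ne_zero.mp hn) a
end
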